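/- arXiv:math/0212014 — 3 statements merged into one kernel-verified Lean document; each statement's English description precedes it below -/
import Mathlib

section
/- (Comparison with Nevai's result.) For the even weight w(x) = (1−x²)^α h(x)|x|^{2λ} on (−1,1), where h is even, real analytic and strictly positive on [−1,1], the recurrence coefficients satisfy a_n = 1/2 + (−1)^{n+1}·λ/(2n) + O(1/n²) and b_n = O(1/n²) as n → ∞. -/
open MeasureTheory Filter Asymptotics

namespace Nevai

/-! ### Chebyshev expansion of smooth functions -/

lemma fourier_decay (N : ℕ) : ∀ f : ℝ → ℂ, ContDiff ℝ (⊤ : ℕ∞) f →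
    (∀ x, f (x + 2 * Real.pi) = f x) →
    ∃ K : ℝ, ∀ n : ℤ, ‖fourierCoeffOn Real.two_pi_pos f n‖ * |(n : ℝ)| ^ N ≤ K := by
  induction N with
  | zero =>
    intro f hf hper
    obtain ⟨K, hK⟩ := (isCompact_uIcc (a := (0:ℝ)) (b := 2 * Real.pi)).exists_bound_of_continuousOn
      hf.continuous.continuousOn
    refine ⟨‖(1 / (2 * Real.pi - 0))‖ * (K * |2 * Real.pi - 0|), fun n => ?_⟩
    rw [pow_zero, mul_one, fourierCoeffOn_eq_integral, norm_smul]
    gcongr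
    apply intervalIntegral.norm_integral_le_of_norm_le_const
    intro x hx
    rw [norm_smul]
    have : ‖(fourier (-n) (x : AddCircle (2 * Real.pi - 0)) : ℂ)‖ = 1 := by
      rw [fourier_apply]; exact Circle.norm_coe _
    rw [this, one_mul]
    exact hK x (Set.uIoc_subset_uIcc hx)
  | succ N ih =>
    intro f hf hper
    have hd : ContDiff ℝ (⊤ : ℕ∞) (deriv f) := by
      have := (contDiff_infty_iff_deriv (𝕜 := ℝ) (f := f)).1 hf
      exact this.2
    have hdiff : Differentiable ℝ f := ((contDiff_infty_iff_deriv (𝕜 := ℝ) (f := f)).1 hf).1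
    have hdper : ∀ x, deriv f (x + 2 * Real.pi) = deriv f x := by
      intro x
      rw [← deriv_comp_add_const]
      congr 1
      funext y; exact hper y
    obtain ⟨K, hK⟩ := ih (deriv f) hd hdper
    refine ⟨max K 0, fun n => ?_⟩
    by_cases hn : n = 0
    · subst hn; simp
    rw [fourierCoeffOn_of_hasDerivAt Real.two_pi_pos hn (f' := deriv f)
      (fun x _ => (hdiff x).hasDerivAt) (hd.continuous.intervalIntegrable _ _)]
    have h0 : f (2 * Real.pi) - f 0 = 0 := by
      have := hper 0; rw [zero_add] at this; rw [this, sub_self]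
    rw [h0, mul_zero, zero_sub]
    refine le_trans ?_ (le_max_left _ _)
    refine le_trans (le_of_eq ?_) (hK n)
    have hn' : |(n:ℝ)| ≠ 0 := by simpa using hn
    simp only [norm_mul, norm_neg, norm_div, norm_one, Complex.norm_I, Complex.ofReal_zero, sub_zero,
      Complex.norm_real, Complex.norm_ofNat, Complex.norm_intCast, Real.norm_eq_abs, abs_of_pos Real.pi_pos]
    have hpi := Real.pi_pos.ne'
    rw [abs_of_pos (two_pos : (0:ℝ) < 2)]
    field_simp
    ring

lemma summable_weight : Summable (fun n : ℤ => ((1 + |(n:ℝ)|) ^ 2)⁻¹) := by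
  have h1 : Summable (fun n : ℕ => ((1 + (n:ℝ)) ^ 2)⁻¹) := by
    have := (summable_nat_add_iff 1).2 (Real.summable_nat_pow_inv.2 (by norm_num : 1 < 2))
    refine this.congr fun n => ?_
    push_cast; ring
  refine Summable.of_nat_of_neg ?_ ?_
  · simpa using h1
  · simpa using h1

lemma cheb_expand (g : ℝ → ℝ) (hg : ContDiff ℝ (⊤ : ℕ∞) (fun θ => g (Real.cos θ))) :
    ∃ c : ℤ → ℝ, Summable (fun k => |c k| * (1 + |(k:ℝ)|) ^ 6) ∧
      ∀ x ∈ Set.Icc (-1 : ℝ) 1,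
        HasSum (fun k => c k * (Polynomial.Chebyshev.T ℝ k).eval x) (g x) := by
  set f : ℝ → ℂ := fun θ => ((g (Real.cos θ) : ℝ) : ℂ) with hf
  have hfc : ContDiff ℝ (⊤ : ℕ∞) f := Complex.ofRealCLM.contDiff.comp hg
  have hper : ∀ x, f (x + 2 * Real.pi) = f x := by
    intro x; simp [hf]
  obtain ⟨K0, hK0⟩ := fourier_decay 0 f hfc hper
  obtain ⟨K8, hK8⟩ := fourier_decay 8 f hfc hper
  have hT : Fact (0 < 2 * Real.pi - 0) := ⟨by simpa using Real.pi_pos⟩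
  have hper' : Function.Periodic f (2 * Real.pi - 0) := by
    intro x; rw [sub_zero]; exact hper x
  set F : C(AddCircle (2 * Real.pi - 0), ℂ) :=
    ⟨hper'.lift, continuous_quot_lift _ hfc.continuous⟩ with hF
  have hco : ∀ n, fourierCoeff F n = fourierCoeffOn Real.two_pi_pos f n := by
    intro n
    rw [fourierCoeffOn_eq_integral, fourierCoeff_eq_intervalIntegral _ _ 0]
    have e : (0 + (2 * Real.pi - 0) : ℝ) = 2 * Real.pi := by ring
    rw [e]
    rfl
  set z : ℤ → ℂ := fun n => fourierCoeffOn Real.two_pi_pos f n with hz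
  have hbd : ∀ n : ℤ, ‖z n‖ * (1 + |(n:ℝ)|) ^ 6 ≤ (2 ^ 7 * (K0 + K8)) * ((1 + |(n:ℝ)|) ^ 2)⁻¹ := by
    intro n
    rw [← div_eq_mul_inv, le_div_iff₀ (by positivity)]
    have h1 := hK0 n
    have h2 := hK8 n
    have h3 : (1 + |(n:ℝ)|) ^ 8 ≤ 2 ^ 7 * (1 ^ 8 + |(n:ℝ)| ^ 8) :=
      add_pow_le zero_le_one (abs_nonneg _) 8
    calc ‖z n‖ * (1 + |(n:ℝ)|) ^ 6 * (1 + |(n:ℝ)|) ^ 2 = ‖z n‖ * (1 + |(n:ℝ)|) ^ 8 := by ring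
      _ ≤ ‖z n‖ * (2 ^ 7 * (1 ^ 8 + |(n:ℝ)| ^ 8)) := by gcongr
      _ = 2 ^ 7 * (‖z n‖ * |(n:ℝ)| ^ 0 + ‖z n‖ * |(n:ℝ)| ^ 8) := by ring
      _ ≤ _ := by gcongr
  have hsum6 : Summable (fun n : ℤ => ‖z n‖ * (1 + |(n:ℝ)|) ^ 6) :=
    Summable.of_nonneg_of_le (fun n => by positivity) hbd (summable_weight.mul_left _)
  have hsumz : Summable z := by
    refine Summable.of_norm_bounded hsum6 fun n => ?_
    have : (1:ℝ) ≤ (1 + |(n:ℝ)|) ^ 6 := one_le_pow₀ (by linarith [abs_nonneg (n:ℝ)])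
    nlinarith [norm_nonneg (z n)]
  have hpt := has_pointwise_sum_fourier_series_of_summable (f := F) (by
    have : fourierCoeff F = z := funext hco
    rw [this]; exact hsumz)
  have hpt' : ∀ θ : ℝ, HasSum (fun n : ℤ => z n * Complex.exp (Complex.I * n * θ)) (f θ) := by
    intro θ
    have := hpt (θ : AddCircle (2 * Real.pi - 0))
    have e : F (θ : AddCircle (2 * Real.pi - 0)) = f θ := rfl
    rw [e] at this
    convert! this using 2 with n
    rw [hco, fourier_coe_apply, smul_eq_mul]
    congr 2
    push_cast
    have : (Real.pi : ℂ) ≠ 0 := by exact_mod_cast Real.pi_pos.ne'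
    rw [sub_zero]
    field_simp
  refine ⟨fun n => (z n).re, ?_, ?_⟩
  · refine Summable.of_nonneg_of_le (fun n => by positivity) (fun n => ?_) hsum6
    gcongr
    exact Complex.abs_re_le_norm _
  · intro x hx
    set θ := Real.arccos x with hθ
    have hcos : Real.cos θ = x := Real.cos_arccos hx.1 hx.2
    have h1 := hpt' θ
    have h2 := hpt' (-θ)
    have h3 := (Complex.reCLM.hasSum ((h1.add h2).mul_left (1/2 : ℂ)))
    have e1 : f θ = (g x : ℂ) := by simp [hf, hcos]
    have e2 : f (-θ) = (g x : ℂ) := by simp [hf, hcos]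
    rw [e1, e2] at h3
    convert! h3 using 1
    · funext n
      rw [← hcos, Polynomial.Chebyshev.T_real_cos]
      have : (1/2 : ℂ) * (z n * Complex.exp (Complex.I * n * θ) +
          z n * Complex.exp (Complex.I * n * ((-θ : ℝ) : ℂ))) = z n * ((Real.cos (n * θ) : ℝ) : ℂ) := by
        push_cast
        rw [Complex.cos]
        have a1 : (n : ℂ) * θ * Complex.I = Complex.I * n * θ := by ring
        have a2 : -((n : ℂ) * θ) * Complex.I = Complex.I * n * -θ := by ring
        rw [a1, a2]; ring
      rw [this, Complex.reCLM_apply, Complex.re_mul_ofReal]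
    · simp; ring


/-! ### Discrete wave equation -/

lemma wave_bound (e : ℕ → ℤ → ℝ) (K : ℕ) (B : ℝ) (hB : 0 ≤ B) (e0 : ∀ n, e 0 n = 0)
    (e1 : ∀ n, |e 1 n| ≤ B)
    (hs : ∀ k, k + 1 ≤ K → ∀ n, |e (k+2) n + e k n - e (k+1) (n+1) - e (k+1) (n-1)| ≤ B) :
    ∀ n, |e K n| ≤ (1 + (K:ℝ)) ^ 2 * B := by
  have hd : ∀ k, k ≤ K → ∀ n, |e (k+1) n - e k (n+1)| ≤ ((k:ℝ)+1) * B := by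
    intro k
    induction k with
    | zero => intro _ n; simpa [e0] using e1 n
    | succ k ih =>
      intro hk n
      have h1 := ih (by omega) (n-1)
      have h2 := hs k (by omega) n
      rw [sub_add_cancel] at h1
      have : e (k+1+1) n - e (k+1) (n+1) =
        (e (k+2) n + e k n - e (k+1) (n+1) - e (k+1) (n-1)) + (e (k+1) (n-1) - e k n) := by ring
      rw [this]
      refine (abs_add_le _ _).trans ?_
      push_cast
      linarith
  have he : ∀ k, k ≤ K → ∀ n, |e k n| ≤ (k:ℝ) * ((1 + (K:ℝ)) * B) := by
    intro k
    induction k with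
    | zero => intro _ n; simp [e0]
    | succ k ih =>
      intro hk n
      have h1 := ih (by omega) (n+1)
      have h2 := hd k (by omega) n
      have : e (k+1) n = (e (k+1) n - e k (n+1)) + e k (n+1) := by ring
      rw [this]
      refine (abs_add_le _ _).trans ?_
      have hk' : ((k:ℝ)+1) * B ≤ (1 + (K:ℝ)) * B := by
        have : (k:ℝ) + 1 ≤ K := by exact_mod_cast hk
        refine mul_le_mul_of_nonneg_right ?_ hB; linarith
      push_cast
      linarith
  intro n
  refine (he K le_rfl n).trans ?_
  have : (0:ℝ) ≤ K := Nat.cast_nonneg K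
  nlinarith [mul_nonneg (by positivity : (0:ℝ) ≤ 1 + K) hB]

/-- The free solution. -/
noncomputable def fr (k : ℕ) (n m : ℤ) : ℝ :=
  ((if n = m + k then 1 else 0) + (if n = m - k then 1 else 0)) / 2

lemma fr_shift (k : ℕ) (n m : ℤ) : fr k (n+1) (m+1) = fr k n m := by
  unfold fr
  have h1 : (n + 1 = m + 1 + k) ↔ (n = m + k) := by omega
  have h2 : (n + 1 = m + 1 - k) ↔ (n = m - k) := by omega
  simp only [h1, h2]

lemma fr_zero (n m : ℤ) : fr 0 n m = if n = m then 1 else 0 := by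
  unfold fr; simp

lemma fr_rec (k : ℕ) (n m : ℤ) :
    fr (k+2) n m + fr k n m = fr (k+1) (n+1) m + fr (k+1) (n-1) m := by
  unfold fr
  push_cast
  have h1 : (n + 1 = m + (k+1)) ↔ (n = m + k) := by omega
  have h2 : (n + 1 = m - (k+1)) ↔ (n = m - (k+2)) := by omega
  have h3 : (n - 1 = m + (k+1)) ↔ (n = m + (k+2)) := by omega
  have h4 : (n - 1 = m - (k+1)) ↔ (n = m - k) := by omega
  simp only [h1, h2, h3, h4]
  ring

lemma fr_one (n m : ℤ) :
    fr 1 n m = (1/2) * (if n + 1 = m then 1 else 0) + (1/2) * (if n - 1 = m then 1 else 0) := by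
  unfold fr
  have h1 : (n = m + (1:ℕ)) ↔ (n - 1 = m) := by omega
  have h2 : (n = m - (1:ℕ)) ↔ (n + 1 = m) := by omega
  simp only [h1, h2]
  ring

/-- Perturbed wave system. -/
structure Wave (A : ℤ → ℝ) (u : ℕ → ℤ → ℤ → ℝ) : Prop where
  h0 : ∀ n m, 0 ≤ m → u 0 n m = if n = m then 1 else 0
  h1 : ∀ n m, 0 ≤ m → u 1 n m = A (n+1) * u 0 (n+1) m + A n * u 0 (n-1) m
  h2 : ∀ k n m, 0 ≤ m →
    u (k+2) n m = 2 * A (n+1) * u (k+1) (n+1) m + 2 * A n * u (k+1) (n-1) m - u k n m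
  hb : ∀ k n m, 0 ≤ m → |u k n m| ≤ 1
  hneg : ∀ k n m, n < 0 → u k n m = 0

lemma Wave.supp {A : ℤ → ℝ} {u : ℕ → ℤ → ℤ → ℝ} (W : Wave A u) (m : ℤ) (hm : 0 ≤ m) :
    ∀ k : ℕ, (∀ n : ℤ, n < m - k ∨ m + k < n → u k n m = 0) ∧
      (∀ n : ℤ, n < m - (k + 1) ∨ m + (k + 1) < n → u (k+1) n m = 0) := by
  have z : ∀ n : ℤ, n < m ∨ m < n → u 0 n m = 0 := by
    intro n hn
    rw [W.h0 n m hm, if_neg]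
    omega
  intro k
  induction k with
  | zero =>
    refine ⟨by simpa using z, fun n hn => ?_⟩
    simp only [Nat.cast_zero, zero_add] at hn ⊢
    rw [W.h1 n m hm, z (n+1) (by omega), z (n-1) (by omega)]; simp
  | succ k ih =>
    refine ⟨by exact_mod_cast ih.2, fun n hn => ?_⟩
    push_cast at hn
    rw [W.h2 k n m hm, ih.2 (n+1) (by omega), ih.2 (n-1) (by omega), ih.1 n (by omega)]
    simp

lemma Wave.bd1 {A : ℤ → ℝ} {u : ℕ → ℤ → ℤ → ℝ} (W : Wave A u) {M : ℝ}
    (q : ℤ → ℝ) (hq : ∀ j, 0 ≤ j → |q j| ≤ M / (1 + j)) (hM : 0 ≤ M) (k : ℕ) (j m : ℤ)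
    (hm : 0 ≤ m) : |q j * u k j m| ≤ M * (1 + k) / (1 + m) := by
  have hm' : (0:ℝ) ≤ m := by exact_mod_cast hm
  by_cases hj : j < 0
  · rw [W.hneg k j m hj, mul_zero, abs_zero]; positivity
  by_cases hk : j < m - k ∨ m + k < j
  · rw [(W.supp m hm k).1 j hk, mul_zero, abs_zero]; positivity
  have hj' : (0:ℝ) ≤ j := by exact_mod_cast (not_lt.1 hj)
  have hjk : (m:ℝ) ≤ j + k := by
    have : m ≤ j + k := by omega
    exact_mod_cast this
  rw [abs_mul]
  calc |q j| * |u k j m| ≤ M / (1 + j) * 1 := by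
        gcongr
        · exact hq j (not_lt.1 hj)
        · exact W.hb k j m hm
    _ ≤ _ := by
        rw [mul_one, div_le_div_iff₀ (by positivity) (by positivity), mul_assoc]
        gcongr
        have : (0:ℝ) ≤ (k:ℝ) * j := by positivity
        nlinarith

lemma dec_shift {M : ℝ} (hM : 0 ≤ M) {v : ℤ → ℝ} (hv : ∀ j, 0 ≤ j → |v j| ≤ M / (1 + j)) (i : ℕ) :
    ∀ j, 0 ≤ j → |v (j + i)| ≤ M / (1 + j) := by
  intro j hj
  have hj' : (0:ℝ) ≤ j := by exact_mod_cast hj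
  refine (hv (j+i) (by omega)).trans ?_
  push_cast
  gcongr
  linarith [(Nat.cast_nonneg i : (0:ℝ) ≤ i)]

lemma Wave.e_bound {A : ℤ → ℝ} {u : ℕ → ℤ → ℤ → ℝ} (W : Wave A u) {M : ℝ} (hM : 0 ≤ M)
    (hv : ∀ j : ℤ, 0 ≤ j → |A j - 1/2| ≤ M / (1 + j)) (k : ℕ) (n m : ℤ) (hm : 0 ≤ m) :
    |u k n m - fr k n m| ≤ 4 * M * (1 + k) ^ 3 / (1 + m) := by
  have hm' : (0:ℝ) ≤ m := by exact_mod_cast hm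
  have b1 := W.bd1 (fun j => A j - 1/2) hv hM
  have b2 := W.bd1 (fun j => A (j + 1) - 1/2) (dec_shift (v := fun j => A j - 1/2) hM hv 1) hM
  have := wave_bound (fun k n => u k n m - fr k n m) k (4 * M * (1 + k) / (1 + m)) (by positivity)
    (fun n => by simp [W.h0 n m hm, fr_zero]) ?_ ?_ n
  · refine this.trans (le_of_eq ?_); ring
  · intro n
    have e : u 1 n m - fr 1 n m = (A (n+1) - 1/2) * u 0 (n+1) m +
        (A (n - 1 + 1) - 1/2) * u 0 (n-1) m := by
      rw [W.h1 n m hm, fr_one, W.h0 _ m hm, W.h0 _ m hm, sub_add_cancel]; ring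
    simp only [e]
    refine (abs_add_le _ _).trans ?_
    refine (add_le_add (b1 0 (n+1) m hm) (b2 0 (n-1) m hm)).trans ?_
    rw [← add_div]
    gcongr
    push_cast
    nlinarith [(Nat.cast_nonneg k : (0:ℝ) ≤ k)]
  · intro i hi n
    have e : (u (i+2) n m - fr (i+2) n m) + (u i n m - fr i n m)
        - (u (i+1) (n+1) m - fr (i+1) (n+1) m) - (u (i+1) (n-1) m - fr (i+1) (n-1) m)
        = 2 * ((A (n+1) - 1/2) * u (i+1) (n+1) m + (A (n - 1 + 1) - 1/2) * u (i+1) (n-1) m) := by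
      have := fr_rec i n m
      rw [W.h2 i n m hm, sub_add_cancel]; linarith
    simp only [e]
    have hi' : (i:ℝ) + 1 ≤ k := by exact_mod_cast hi
    rw [abs_mul, abs_two]
    have t := (abs_add_le ((A (n+1) - 1/2) * u (i+1) (n+1) m)
      ((A (n - 1 + 1) - 1/2) * u (i+1) (n-1) m)).trans
      (add_le_add (b1 (i+1) (n+1) m hm) (b2 (i+1) (n-1) m hm))
    have t2 : M * (1 + ((i+1 : ℕ):ℝ)) / (1 + m) ≤ M * (1 + k) / (1 + m) := by
      gcongr
    calc _ ≤ 2 * (M * (1 + k) / (1 + m) + M * (1 + k) / (1 + m)) := by linarith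
      _ = _ := by ring

/-- the decay `1/(x √x)`. -/
noncomputable def dec (x : ℝ) : ℝ := 1 / (x * Real.sqrt x)

lemma dec_nonneg {x : ℝ} (hx : 0 ≤ x) : 0 ≤ dec x := by unfold dec; positivity

lemma dec_le {x y k : ℝ} (hx : 1 ≤ x) (hy : 1 ≤ y) (hk : 1 ≤ k) (h : x ≤ k * y) :
    dec y ≤ k ^ 2 * dec x := by
  unfold dec
  have hsx : 0 < Real.sqrt x := Real.sqrt_pos.2 (by linarith)
  have hsy : 0 < Real.sqrt y := Real.sqrt_pos.2 (by linarith)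
  rw [mul_one_div, div_le_div_iff₀ (by positivity) (by positivity), one_mul]
  have h1 : Real.sqrt x ≤ k * Real.sqrt y := by
    rw [Real.sqrt_le_left (by positivity), mul_pow, Real.sq_sqrt (by linarith)]
    nlinarith
  calc x * Real.sqrt x ≤ (k * y) * (k * Real.sqrt y) := by gcongr
    _ = _ := by ring

lemma dec_ge {x : ℝ} (hx : 1 ≤ x) : 1 / x ^ 2 ≤ dec x := by
  unfold dec
  have hsx : 0 < Real.sqrt x := Real.sqrt_pos.2 (by linarith)
  have h1 : Real.sqrt x ≤ x := by
    rw [Real.sqrt_le_left (by linarith)]; nlinarith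
  gcongr
  nlinarith

lemma Wave.bd2 {A : ℤ → ℝ} {u : ℕ → ℤ → ℤ → ℝ} (W : Wave A u) {M : ℝ}
    (q : ℤ → ℝ) (hq : ∀ j : ℤ, 0 ≤ j → |q j| ≤ M * dec (1 + j)) (hM : 0 ≤ M) (k : ℕ) (j m : ℤ)
    (hm : 0 ≤ m) : |q j * u k j m| ≤ M * (1 + k) ^ 2 * dec (1 + m) := by
  have hm' : (0:ℝ) ≤ m := by exact_mod_cast hm
  have hd := dec_nonneg (by linarith : (0:ℝ) ≤ 1 + m)
  by_cases hj : j < 0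
  · rw [W.hneg k j m hj, mul_zero, abs_zero]; positivity
  by_cases hk : j < m - k ∨ m + k < j
  · rw [(W.supp m hm k).1 j hk, mul_zero, abs_zero]; positivity
  have hj' : (0:ℝ) ≤ j := by exact_mod_cast (not_lt.1 hj)
  have hjk : (m:ℝ) ≤ j + k := by
    have : m ≤ j + k := by omega
    exact_mod_cast this
  have hdj := dec_nonneg (by linarith : (0:ℝ) ≤ 1 + j)
  rw [abs_mul]
  calc |q j| * |u k j m| ≤ M * dec (1 + j) * 1 := by
        gcongr
        · exact hq j (not_lt.1 hj)
        · exact W.hb k j m hm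
    _ ≤ _ := by
        rw [mul_one, mul_assoc]
        gcongr
        apply dec_le (by linarith) (by linarith) (by linarith [(Nat.cast_nonneg k : (0:ℝ) ≤ k)])
        have : (0:ℝ) ≤ (k:ℝ) * j := by positivity
        nlinarith

lemma dec_shift2 {M : ℝ} (hM : 0 ≤ M) {v : ℤ → ℝ} (hv : ∀ j : ℤ, 0 ≤ j → |v j| ≤ M * dec (1 + j)) :
    ∀ j : ℤ, 0 ≤ j → |v (j + 1)| ≤ M * dec (1 + j) := by
  intro j hj
  have hj' : (0:ℝ) ≤ j := by exact_mod_cast hj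
  refine (hv (j+1) (by omega)).trans ?_
  gcongr
  have := dec_le (x := 1 + j) (y := 1 + ((j + 1 : ℤ) : ℝ)) (k := 1) (by linarith)
    (by push_cast; linarith) le_rfl (by push_cast; linarith)
  simpa using this

lemma Wave.diff_bd {A : ℤ → ℝ} {u : ℕ → ℤ → ℤ → ℝ} (W : Wave A u) {M : ℝ} (hM : 0 ≤ M)
    (hv : ∀ j : ℤ, 0 ≤ j → |A j - 1/2| ≤ M / (1 + j)) (k i : ℕ) (j m : ℤ) (hm : 0 ≤ m)
    (hi : 1 ≤ i) :
    |(A (j + i) - 1/2) * (u k (j+1) (m+1) - u k j m)| ≤ 8 * M ^ 2 * (1 + k) ^ 4 * dec (1 + m) := by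
  have hm' : (0:ℝ) ≤ m := by exact_mod_cast hm
  have hd := dec_nonneg (by linarith : (0:ℝ) ≤ 1 + m)
  by_cases hj : j < -1
  · rw [W.hneg k j m (by omega), W.hneg k (j+1) (m+1) (by omega), sub_zero, mul_zero, abs_zero]
    positivity
  by_cases hk : j < m - k ∨ m + k < j
  · rw [(W.supp m hm k).1 j hk, (W.supp (m+1) (by omega) k).1 (j+1) (by omega), sub_zero, mul_zero,
      abs_zero]
    positivity
  have hj' : (-1:ℝ) ≤ j := by exact_mod_cast (not_lt.1 hj)
  have hi' : (1:ℝ) ≤ i := by exact_mod_cast hi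
  have hk' : (0:ℝ) ≤ k := Nat.cast_nonneg k
  have hjk : (m:ℝ) ≤ j + k := by
    have : m ≤ j + k := by omega
    exact_mod_cast this
  have a1 : |A (j + i) - 1/2| ≤ M * (1 + k) / (1 + m) := by
    refine (hv (j+i) (by omega)).trans ?_
    push_cast
    rw [div_le_div_iff₀ (by linarith) (by positivity), mul_assoc]
    gcongr
    nlinarith [mul_nonneg hk' (by linarith : (0:ℝ) ≤ j + i)]
  have a2 : |u k (j+1) (m+1) - u k j m| ≤ 8 * M * (1 + k) ^ 3 / (1 + m) := by
    have e1 := W.e_bound hM hv k (j+1) (m+1) (by omega)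
    have e2 := W.e_bound hM hv k j m hm
    rw [fr_shift] at e1
    have e3 : 4 * M * (1 + (k:ℝ)) ^ 3 / (1 + ((m + 1 : ℤ) : ℝ)) ≤ 4 * M * (1 + k) ^ 3 / (1 + m) := by
      gcongr
      linarith
    have : u k (j+1) (m+1) - u k j m = (u k (j+1) (m+1) - fr k j m) - (u k j m - fr k j m) := by ring
    rw [this]
    refine (abs_sub _ _).trans ?_
    calc _ ≤ 4 * M * (1 + (k:ℝ)) ^ 3 / (1 + m) + 4 * M * (1 + k) ^ 3 / (1 + m) := by linarith
      _ = _ := by ring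
  rw [abs_mul]
  calc _ ≤ (M * (1 + k) / (1 + m)) * (8 * M * (1 + k) ^ 3 / (1 + m)) := by gcongr
    _ = 8 * M ^ 2 * (1 + k) ^ 4 * (1 / (1 + m) ^ 2) := by field_simp
    _ ≤ _ := by gcongr; exact dec_ge (by linarith)

lemma Wave.s_bound {A : ℤ → ℝ} {u : ℕ → ℤ → ℤ → ℝ} (W : Wave A u) {M : ℝ} (hM : 0 ≤ M)
    (hv : ∀ j : ℤ, 0 ≤ j → |A j - 1/2| ≤ M / (1 + j))
    (hv2 : ∀ j : ℤ, 0 ≤ j → |A j + A (j + 1) - 1| ≤ M * dec (1 + j))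
    (k : ℕ) (n m : ℤ) (hm : 0 ≤ m) :
    |(u k n m - fr k n m) + (u k (n+1) (m+1) - fr k (n+1) (m+1))|
      ≤ (4 * M + 32 * M ^ 2) * (1 + k) ^ 6 * dec (1 + m) := by
  have hm' : (0:ℝ) ≤ m := by exact_mod_cast hm
  have hd := dec_nonneg (by linarith : (0:ℝ) ≤ 1 + m)
  have hk0 : (0:ℝ) ≤ k := Nat.cast_nonneg k
  have b1 := W.bd2 (fun j => A j + A (j + 1) - 1) hv2 hM
  have b2 := W.bd2 (fun j => A (j + 1) + A (j + 1 + 1) - 1)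
    (dec_shift2 (v := fun j => A j + A (j + 1) - 1) hM hv2) hM
  have hm1 : 0 ≤ m + 1 := by omega
  have := wave_bound (fun k n => (u k n m - fr k n m) + (u k (n+1) (m+1) - fr k (n+1) (m+1))) k
    ((4 * M + 32 * M ^ 2) * (1 + k) ^ 4 * dec (1 + m)) (by positivity)
    (fun n => by simp [W.h0 _ m hm, W.h0 _ (m+1) hm1, fr_zero]) ?_ ?_ n
  · refine this.trans (le_of_eq ?_); ring
  · intro n
    have e : (u 1 n m - fr 1 n m) + (u 1 (n+1) (m+1) - fr 1 (n+1) (m+1))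
        = (A (n+1) + A (n+1+1) - 1) * u 0 (n+1) m +
          (A (n-1+1) + A (n-1+1+1) - 1) * u 0 (n-1) m := by
      rw [fr_shift, W.h1 n m hm, W.h1 (n+1) (m+1) hm1, fr_one, W.h0 _ m hm, W.h0 _ m hm,
        W.h0 _ (m+1) hm1, W.h0 _ (m+1) hm1, sub_add_cancel]
      have h1 : (n + 1 + 1 = m + 1) ↔ (n + 1 = m) := by omega
      have h2 : (n + 1 - 1 = m + 1) ↔ (n - 1 = m) := by omega
      simp only [h1, h2]
      ring
    simp only [e]
    refine (abs_add_le _ _).trans ?_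
    refine (add_le_add (b1 0 (n+1) m hm) (b2 0 (n-1) m hm)).trans ?_
    push_cast
    have h1 : (1:ℝ) ≤ (1 + k) ^ 4 := one_le_pow₀ (by linarith)
    calc _ = (2 * M) * 1 * dec (1 + m) := by ring
      _ ≤ _ := by gcongr; nlinarith
  · intro i hi n
    have e : ((u (i+2) n m - fr (i+2) n m) + (u (i+2) (n+1) (m+1) - fr (i+2) (n+1) (m+1)))
        + ((u i n m - fr i n m) + (u i (n+1) (m+1) - fr i (n+1) (m+1)))
        - ((u (i+1) (n+1) m - fr (i+1) (n+1) m) +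
            (u (i+1) (n+1+1) (m+1) - fr (i+1) (n+1+1) (m+1)))
        - ((u (i+1) (n-1) m - fr (i+1) (n-1) m) +
            (u (i+1) (n-1+1) (m+1) - fr (i+1) (n-1+1) (m+1)))
        = 2 * (((A (n+1) + A (n+1+1) - 1) * u (i+1) (n+1) m
            + (A (n-1+1) + A (n-1+1+1) - 1) * u (i+1) (n-1) m)
          + ((A (n+1+(1:ℕ)) - 1/2) * (u (i+1) (n+1+1) (m+1) - u (i+1) (n+1) m)
            + (A (n-1+(2:ℕ)) - 1/2) * (u (i+1) (n-1+1) (m+1) - u (i+1) (n-1) m))) := by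
      have h1 := fr_rec i n m
      simp only [fr_shift]
      have e1 : n - 1 + ((2:ℕ):ℤ) = n + 1 := by push_cast; ring
      rw [W.h2 i n m hm, W.h2 i (n+1) (m+1) hm1, e1, Nat.cast_one]
      simp only [sub_add_cancel, add_sub_cancel_right]
      linear_combination (-2) * h1
    simp only [e]
    have hi' : (i:ℝ) + 1 ≤ k := by exact_mod_cast hi
    rw [abs_mul, abs_two]
    have t := (abs_add_le _ _).trans (add_le_add
      ((abs_add_le _ _).trans (add_le_add (b1 (i+1) (n+1) m hm) (b2 (i+1) (n-1) m hm)))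
      ((abs_add_le _ _).trans (add_le_add (W.diff_bd hM hv (i+1) 1 (n+1) m hm le_rfl)
        (W.diff_bd hM hv (i+1) 2 (n-1) m hm (by norm_num)))))
    have hik : (1 + ((i+1 : ℕ):ℝ)) ≤ 1 + k := by push_cast; linarith
    have t2 : M * (1 + ((i+1 : ℕ):ℝ)) ^ 2 * dec (1 + m) ≤ M * (1 + k) ^ 4 * dec (1 + m) := by
      gcongr ?_ * ?_ * ?_
      calc _ ≤ (1 + (k:ℝ)) ^ 2 := by gcongr
        _ ≤ _ := pow_le_pow_right₀ (by linarith) (by norm_num)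
    have t3 : 8 * M ^ 2 * (1 + ((i+1 : ℕ):ℝ)) ^ 4 * dec (1 + m)
        ≤ 8 * M ^ 2 * (1 + k) ^ 4 * dec (1 + m) := by
      gcongr
    calc _ ≤ 2 * ((M * (1 + k) ^ 4 * dec (1 + m) + M * (1 + k) ^ 4 * dec (1 + m)) +
            (8 * M ^ 2 * (1 + k) ^ 4 * dec (1 + m) + 8 * M ^ 2 * (1 + k) ^ 4 * dec (1 + m))) := by
          linarith
      _ = _ := by ring

lemma fr_le (k : ℕ) (n m : ℤ) : |fr k n m| ≤ 1 := by
  unfold fr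
  split_ifs <;> norm_num

lemma fr_diag (k : ℕ) (m : ℤ) : fr k (m+1) m = fr k 1 0 := by
  unfold fr
  have h1 : (m + 1 = m + k) ↔ ((1:ℤ) = 0 + k) := by omega
  have h2 : (m + 1 = m - k) ↔ ((1:ℤ) = 0 - k) := by omega
  simp only [h1, h2]

lemma hasSum_fr (c : ℤ → ℝ) (hc : Summable (fun k => |c k| * (1 + |(k:ℝ)|) ^ 6)) :
    HasSum (fun k => c k * fr k.natAbs 1 0) (∑' k : ℤ, c k * fr k.natAbs 1 0) := by
  apply Summable.hasSum
  refine Summable.of_norm_bounded hc fun k => ?_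
  rw [Real.norm_eq_abs, abs_mul]
  gcongr
  exact (fr_le _ _ _).trans (one_le_pow₀ (by linarith [abs_nonneg (k:ℝ)]))

lemma Wave.E_bound {A : ℤ → ℝ} {u : ℕ → ℤ → ℤ → ℝ} (W : Wave A u) {M : ℝ} (hM : 0 ≤ M)
    (hv : ∀ j : ℤ, 0 ≤ j → |A j - 1/2| ≤ M / (1 + j))
    (c : ℤ → ℝ) (hc : Summable (fun k => |c k| * (1 + |(k:ℝ)|) ^ 6))
    (E : ℤ → ℝ) (hE : ∀ m : ℤ, 0 ≤ m → HasSum (fun k => c k * u k.natAbs (m+1) m) (E m))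
    (m : ℤ) (hm : 0 ≤ m) :
    |E m - ∑' k : ℤ, c k * fr k.natAbs 1 0|
      ≤ (∑' k, |c k| * (1 + |(k:ℝ)|) ^ 6) * (4 * M / (1 + m)) := by
  have hm' : (0:ℝ) ≤ m := by exact_mod_cast hm
  have h1 := (hE m hm).sub (hasSum_fr c hc)
  refine h1.norm_le_of_bounded (hc.hasSum.mul_right (4 * M / (1 + m))) fun k => ?_
  rw [← fr_diag _ m, ← mul_sub, Real.norm_eq_abs, abs_mul, mul_assoc]
  gcongr
  have := W.e_bound hM hv k.natAbs (m+1) m hm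
  rw [Nat.cast_natAbs, Int.cast_abs] at this
  refine this.trans ?_
  have h3 : (1 + |(k:ℝ)|) ^ 3 ≤ (1 + |(k:ℝ)|) ^ 6 :=
    pow_le_pow_right₀ (by linarith [abs_nonneg (k:ℝ)]) (by norm_num)
  rw [mul_comm (4 * M), mul_div_assoc]
  gcongr

lemma Wave.S_bound {A : ℤ → ℝ} {u : ℕ → ℤ → ℤ → ℝ} (W : Wave A u) {M : ℝ} (hM : 0 ≤ M)
    (hv : ∀ j : ℤ, 0 ≤ j → |A j - 1/2| ≤ M / (1 + j))
    (hv2 : ∀ j : ℤ, 0 ≤ j → |A j + A (j + 1) - 1| ≤ M * dec (1 + j))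
    (c : ℤ → ℝ) (hc : Summable (fun k => |c k| * (1 + |(k:ℝ)|) ^ 6))
    (E : ℤ → ℝ) (hE : ∀ m : ℤ, 0 ≤ m → HasSum (fun k => c k * u k.natAbs (m+1) m) (E m))
    (m : ℤ) (hm : 0 ≤ m) :
    |E m + E (m+1) - 2 * ∑' k : ℤ, c k * fr k.natAbs 1 0|
      ≤ (∑' k, |c k| * (1 + |(k:ℝ)|) ^ 6) * ((4 * M + 32 * M ^ 2) * dec (1 + m)) := by
  have hm' : (0:ℝ) ≤ m := by exact_mod_cast hm
  have h1 := ((hE m hm).add (hE (m+1) (by omega))).sub ((hasSum_fr c hc).mul_left 2)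
  refine h1.norm_le_of_bounded (hc.hasSum.mul_right ((4 * M + 32 * M ^ 2) * dec (1 + m))) fun k => ?_
  have e : c k * u k.natAbs (m+1) m + c k * u k.natAbs (m+1+1) (m+1) - 2 * (c k * fr k.natAbs 1 0)
      = c k * ((u k.natAbs (m+1) m - fr k.natAbs (m+1) m) +
        (u k.natAbs (m+1+1) (m+1) - fr k.natAbs (m+1+1) (m+1))) := by
    rw [fr_diag, fr_diag]; ring
  rw [e, Real.norm_eq_abs, abs_mul, mul_assoc]
  gcongr
  have := W.s_bound hM hv hv2 k.natAbs (m+1) m hm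
  rw [Nat.cast_natAbs, Int.cast_abs] at this
  refine this.trans (le_of_eq ?_)
  ring

/-! ### Bootstrap -/

lemma boot_identity (a E σ : ℕ → ℝ) (c lam C : ℝ)
    (hσ : ∀ n : ℕ, 1 ≤ n → σ (n+1) = σ n + a n ^ 2)
    (hR : ∀ n : ℕ, 1 ≤ n → (n:ℝ) - 2 * σ n + lam * (1 - (-1) ^ n) + a n * E n
      = (2 * n + 1 + c) * a n ^ 2) :
    ∃ κ : ℝ, ∀ n : ℕ, 1 ≤ n →
      (4 * (n:ℝ) ^ 2 + 4 * c * n + c ^ 2 - 1) * (a n ^ 2 - 1/4)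
        = -lam * (-1) ^ n * (2 * n + c) + (2 * n - 1 + c) * (a n * E n - C / 2)
          - 2 * ∑ k ∈ Finset.Ico 1 n, (a k * E k - C / 2) + κ := by
  refine ⟨(4 * ((1:ℕ):ℝ) ^ 2 + 4 * c * (1:ℕ) + c ^ 2 - 1) * (a 1 ^ 2 - 1/4)
    - (-lam * (-1) ^ 1 * (2 * (1:ℕ) + c) + (2 * (1:ℕ) - 1 + c) * (a 1 * E 1 - C / 2)), ?_⟩
  intro n hn
  induction n, hn using Nat.le_induction with
  | base => simp
  | succ n hn ih =>
    rw [Finset.sum_Ico_succ_top hn]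
    have r1 := hR n hn
    have r2 := hR (n+1) (by omega)
    rw [hσ n hn] at r2
    push_cast at r2 ⊢
    rw [pow_succ] at r2
    rw [pow_succ (-1 : ℝ)]
    linear_combination ih + (2 * (n:ℝ) + 1 + c) * (r1 - r2)

set_option maxHeartbeats 1000000 in
lemma boot_main (a E σ : ℕ → ℝ) (c lam C : ℝ)
    (hpos : ∀ n : ℕ, 1 ≤ n → 0 < a n) (hle : ∀ n : ℕ, 1 ≤ n → a n ≤ 1)
    (hσ : ∀ n : ℕ, 1 ≤ n → σ (n+1) = σ n + a n ^ 2)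
    (hR : ∀ n : ℕ, 1 ≤ n → (n:ℝ) - 2 * σ n + lam * (1 - (-1) ^ n) + a n * E n
      = (2 * n + 1 + c) * a n ^ 2) :
    ∃ K : ℝ, 0 ≤ K ∧ ∀ n : ℕ, 1 ≤ n →
      (n:ℝ) ^ 2 * |a n ^ 2 - 1/4 + lam * (-1) ^ n / (2 * n)|
        ≤ K + K * (n * |a n * E n - C / 2|) + |∑ k ∈ Finset.Ico 1 n, (a k * E k - C / 2)| := by
  obtain ⟨κ, hκ⟩ := boot_identity a E σ c lam C hσ hR
  obtain ⟨N, hN⟩ := exists_nat_ge (4 * |c| + 2)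
  set K : ℝ := (N:ℝ) ^ 2 * (1 + |lam|) + |lam| * (|c| + c ^ 2 + 1) + |κ| + (3 + |c|) with hK
  have hK0 : 0 ≤ K := by positivity
  refine ⟨K, hK0, fun n hn => ?_⟩
  have hn' : (1:ℝ) ≤ n := by exact_mod_cast hn
  set H := a n * E n - C / 2 with hH
  set S := ∑ k ∈ Finset.Ico 1 n, (a k * E k - C / 2) with hS
  set X := a n ^ 2 - 1/4 + lam * (-1) ^ n / (2 * n) with hX
  have hsgn : |(-1 : ℝ) ^ n| = 1 := by simp
  by_cases hnN : (n:ℝ) ≤ N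
  · have hXb : |X| ≤ 1 + |lam| := by
      refine (abs_add_le _ _).trans (add_le_add ?_ ?_)
      · rw [abs_le]; constructor <;> nlinarith [hpos n hn, hle n hn, sq_nonneg (a n)]
      · rw [abs_div, abs_mul, hsgn, mul_one, abs_of_pos (by positivity : (0:ℝ) < 2 * n)]
        apply div_le_self (abs_nonneg _) (by linarith)
    have h1 : (n:ℝ) ^ 2 * |X| ≤ (N:ℝ) ^ 2 * (1 + |lam|) := by gcongr
    have h2 : (N:ℝ) ^ 2 * (1 + |lam|) ≤ K := by
      rw [hK]
      have : 0 ≤ |lam| * (|c| + c ^ 2 + 1) + |κ| + (3 + |c|) := by positivity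
      linarith
    have h3 : 0 ≤ K * (n * |H|) := by positivity
    linarith [abs_nonneg S]
  · have hQ : 2 * (n:ℝ) ^ 2 ≤ 4 * (n:ℝ) ^ 2 + 4 * c * n + c ^ 2 - 1 := by
      have : 4 * |c| + 2 ≤ n := by linarith
      have h1 : -(|c| * n) ≤ c * n := by
        have := neg_abs_le c
        nlinarith
      nlinarith [sq_nonneg c, abs_nonneg c]
    have hid : (4 * (n:ℝ) ^ 2 + 4 * c * n + c ^ 2 - 1) * X
        = lam * (-1) ^ n * (c + (c ^ 2 - 1) / (2 * n)) + (2 * n - 1 + c) * H - 2 * S + κ := by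
      rw [hX, mul_add, hκ n hn, ← hH, ← hS]
      field_simp
      ring
    have hb : |(4 * (n:ℝ) ^ 2 + 4 * c * n + c ^ 2 - 1) * X|
        ≤ |lam| * (|c| + c ^ 2 + 1) + (3 + |c|) * (n * |H|) + 2 * |S| + |κ| := by
      rw [hid]
      refine (abs_add_le _ _).trans ?_
      gcongr
      refine (abs_sub _ _).trans ?_
      rw [abs_mul 2 S, abs_two]
      gcongr
      refine (abs_add_le _ _).trans ?_
      gcongr
      · rw [abs_mul, abs_mul, hsgn, mul_one]
        gcongr
        refine (abs_add_le _ _).trans ?_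
        rw [add_assoc]
        gcongr
        rw [abs_div, abs_of_pos (by positivity : (0:ℝ) < 2 * n)]
        refine (div_le_self (abs_nonneg _) (by linarith)).trans ?_
        rw [abs_le]; constructor <;> nlinarith [sq_nonneg c]
      · rw [abs_mul, ← mul_assoc]
        gcongr
        have h1 := abs_le.1 (le_refl |c|)
        rw [abs_le]; constructor <;> nlinarith [abs_nonneg c]
    have hn2 := sq_nonneg (n:ℝ)
    rw [abs_mul, abs_of_nonneg (by linarith)] at hb
    have h1 : 2 * (n:ℝ) ^ 2 * |X| ≤ (4 * (n:ℝ) ^ 2 + 4 * c * n + c ^ 2 - 1) * |X| := by gcongr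
    have h2 : |lam| * (|c| + c ^ 2 + 1) + |κ| ≤ K := by
      rw [hK]
      have : 0 ≤ (N:ℝ) ^ 2 * (1 + |lam|) + (3 + |c|) := by positivity
      linarith
    have h3 : (3 + |c|) * (n * |H|) ≤ K * (n * |H|) := by
      gcongr
      rw [hK]
      have : 0 ≤ (N:ℝ) ^ 2 * (1 + |lam|) + |lam| * (|c| + c ^ 2 + 1) + |κ| := by positivity
      linarith
    have h4 : 0 ≤ K * (n * |H|) := by positivity
    linarith

lemma sum_inv_le (n : ℕ) : ∑ k ∈ Finset.Ico 1 n, 1 / (k:ℝ) ≤ 4 * Real.sqrt n := by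
  rcases Nat.eq_zero_or_pos n with h | h
  · subst h; simp
  induction n, h using Nat.le_induction with
  | base => simp
  | succ n hn ih =>
    rw [Finset.sum_Ico_succ_top hn]
    have hn' : (1:ℝ) ≤ n := by exact_mod_cast hn
    refine (add_le_add_left ih _).trans ?_
    push_cast
    have hs : Real.sqrt n ^ 2 = n := Real.sq_sqrt (by linarith)
    have hs1 : Real.sqrt (n+1) ^ 2 = n + 1 := Real.sq_sqrt (by linarith)
    have h1 : 1 ≤ Real.sqrt n := by rw [Real.one_le_sqrt]; exact hn'
    have h2 : Real.sqrt n ≤ Real.sqrt (n+1) := Real.sqrt_le_sqrt (by linarith)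
    have h3 : (Real.sqrt (n+1) - Real.sqrt n) * (Real.sqrt (n+1) + Real.sqrt n) = 1 := by nlinarith
    have h4 : Real.sqrt (n+1) + Real.sqrt n ≤ 4 * n := by nlinarith
    have h5 : 1 / (n:ℝ) ≤ 4 * (Real.sqrt (n+1) - Real.sqrt n) := by
      rw [div_le_iff₀ (by positivity)]
      have : 0 ≤ Real.sqrt (n+1) - Real.sqrt n := by linarith
      nlinarith
    linarith

lemma summable_dec : Summable (fun n : ℕ => dec n) := by
  have := Real.summable_one_div_nat_rpow.2 (by norm_num : (1:ℝ) < 3/2)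
  refine this.congr fun n => ?_
  unfold dec
  congr 1
  rcases Nat.eq_zero_or_pos n with h | h
  · subst h; norm_num
  have : (0:ℝ) < n := by exact_mod_cast h
  rw [Real.sqrt_eq_rpow, show (3/2 : ℝ) = 1 + 1/2 by norm_num, Real.rpow_add this, Real.rpow_one]

theorem bootstrap (a E σ : ℕ → ℝ) (c lam C B : ℝ)
    (hpos : ∀ n : ℕ, 1 ≤ n → 0 < a n) (hle : ∀ n : ℕ, 1 ≤ n → a n ≤ 1)
    (hE : ∀ n : ℕ, 1 ≤ n → |E n| ≤ B)
    (hσ : ∀ n : ℕ, 1 ≤ n → σ (n+1) = σ n + a n ^ 2)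
    (hR : ∀ n : ℕ, 1 ≤ n → (n:ℝ) - 2 * σ n + lam * (1 - (-1) ^ n) + a n * E n
      = (2 * n + 1 + c) * a n ^ 2)
    (hW1 : ∀ M : ℝ, 0 ≤ M → (∀ n : ℕ, 1 ≤ n → |a n - 1/2| ≤ M / n) →
      ∃ K : ℝ, 0 ≤ K ∧ ∀ n : ℕ, 1 ≤ n → |E n - C| ≤ K / n)
    (hW2 : ∀ M : ℝ, 0 ≤ M → (∀ n : ℕ, 1 ≤ n → |a n - 1/2| ≤ M / n) →
      (∀ n : ℕ, 1 ≤ n → |a n + a (n+1) - 1| ≤ M * dec n) →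
      ∃ K : ℝ, 0 ≤ K ∧ ∀ n : ℕ, 1 ≤ n → |E n + E (n+1) - 2 * C| ≤ K * dec n) :
    ∃ K : ℝ, ∀ n : ℕ, 1 ≤ n →
      |a n - (1/2 + (-1) ^ (n+1) * lam / (2 * n))| ≤ K / (n:ℝ) ^ 2 := by
  obtain ⟨K0, hK0, hmain⟩ := boot_main a E σ c lam C hpos hle hσ hR
  have hB : 0 ≤ B := (abs_nonneg _).trans (hE 1 le_rfl)
  obtain ⟨H, hHdef⟩ : ∃ H : ℕ → ℝ, ∀ k, H k = a k * E k - C / 2 := ⟨_, fun _ => rfl⟩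
  obtain ⟨X, hXdef⟩ : ∃ X : ℕ → ℝ, ∀ n : ℕ, X n = a n ^ 2 - 1/4 + lam * (-1) ^ n / (2 * n) :=
    ⟨_, fun _ => rfl⟩
  simp only [← hHdef, ← hXdef] at hmain
  have hsgn : ∀ n : ℕ, |(-1 : ℝ) ^ n| = 1 := by simp
  have hH1 : ∀ n : ℕ, 1 ≤ n → |H n| ≤ B + |C| := by
    intro n hn
    rw [hHdef]
    refine (abs_sub _ _).trans (add_le_add ?_ ?_)
    · rw [abs_mul, abs_of_pos (hpos n hn)]
      calc a n * |E n| ≤ 1 * B := by gcongr; exacts [hle n hn, hE n hn]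
        _ = B := one_mul _
    · rw [abs_div, abs_two]; linarith [abs_nonneg C]
  have hX1 : ∀ n : ℕ, 1 ≤ n → |X n| ≤ (K0 + K0 * (B + |C|) + (B + |C|)) / n := by
    intro n hn
    have hn' : (1:ℝ) ≤ n := by exact_mod_cast hn
    have h1 := hmain n hn
    have h2 : |∑ k ∈ Finset.Ico 1 n, H k| ≤ n * (B + |C|) := by
      refine (Finset.abs_sum_le_sum_abs _ _).trans ?_
      refine (Finset.sum_le_card_nsmul _ _ (B + |C|) ?_).trans ?_
      · intro k hk; exact hH1 k (Finset.mem_Ico.1 hk).1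
      · rw [nsmul_eq_mul]
        gcongr
        simp
    have h3 : K0 * (n * |H n|) ≤ K0 * (n * (B + |C|)) := by gcongr; exact hH1 n hn
    rw [le_div_iff₀ (by linarith)]
    have h4 : K0 ≤ K0 * n := by nlinarith
    have h5 : (n:ℝ) * (|X n| * n) ≤ n * (K0 + K0 * (B + |C|) + (B + |C|)) := by nlinarith
    exact le_of_mul_le_mul_left h5 (by linarith)
  obtain ⟨M, hM, hv⟩ : ∃ M : ℝ, 0 ≤ M ∧ ∀ n : ℕ, 1 ≤ n → |a n - 1/2| ≤ M / n := by
    refine ⟨2 * ((K0 + K0 * (B + |C|) + (B + |C|)) + |lam|), by positivity, fun n hn => ?_⟩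
    have hn' : (1:ℝ) ≤ n := by exact_mod_cast hn
    have h1 : |a n ^ 2 - 1/4| ≤ (K0 + K0 * (B + |C|) + (B + |C|)) / n + |lam| / n := by
      have : a n ^ 2 - 1/4 = X n - lam * (-1) ^ n / (2 * n) := by rw [hXdef]; ring
      rw [this]
      refine (abs_sub _ _).trans (add_le_add (hX1 n hn) ?_)
      rw [abs_div, abs_mul, hsgn, mul_one, abs_of_pos (by positivity : (0:ℝ) < 2 * n)]
      gcongr
      linarith
    have h2 : |a n ^ 2 - 1/4| = |a n - 1/2| * (a n + 1/2) := by
      rw [← abs_of_pos (by linarith [hpos n hn] : 0 < a n + 1/2), ← abs_mul]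
      congr 1
      ring
    have h3 : |a n - 1/2| ≤ 2 * |a n ^ 2 - 1/4| := by
      rw [h2]; nlinarith [hpos n hn, abs_nonneg (a n - 1/2)]
    calc _ ≤ 2 * ((K0 + K0 * (B + |C|) + (B + |C|)) / n + |lam| / n) := by linarith
      _ = _ := by ring
  obtain ⟨K1, hK1, hE1⟩ := hW1 M hM hv
  have hH2 : ∀ n : ℕ, 1 ≤ n → |H n| ≤ (M * B + K1) / n := by
    intro n hn
    have hn' : (1:ℝ) ≤ n := by exact_mod_cast hn
    have : H n = (a n - 1/2) * E n + (E n - C) / 2 := by rw [hHdef]; ring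
    rw [this]
    refine (abs_add_le _ _).trans ?_
    rw [abs_mul, abs_div, abs_two]
    have h1 : |a n - 1/2| * |E n| ≤ M / n * B := by gcongr; exacts [hv n hn, hE n hn]
    have h2 := hE1 n hn
    calc _ ≤ M / n * B + K1 / n := by linarith [abs_nonneg (E n - C)]
      _ = _ := by ring
  obtain ⟨K2, hK2def⟩ : ∃ K2, K2 = M * B + K1 := ⟨_, rfl⟩
  rw [← hK2def] at hH2
  have hK2 : 0 ≤ K2 := by rw [hK2def]; positivity
  have hX2 : ∀ n : ℕ, 1 ≤ n → |X n| ≤ (K0 + K0 * K2 + 4 * K2) * dec n := by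
    intro n hn
    have hn' : (1:ℝ) ≤ n := by exact_mod_cast hn
    have h1 := hmain n hn
    have h2 : |∑ k ∈ Finset.Ico 1 n, H k| ≤ K2 * (4 * Real.sqrt n) := by
      refine (Finset.abs_sum_le_sum_abs _ _).trans ?_
      calc _ ≤ ∑ k ∈ Finset.Ico 1 n, K2 * (1 / (k:ℝ)) := by
            apply Finset.sum_le_sum
            intro k hk
            rw [mul_one_div]
            exact hH2 k (Finset.mem_Ico.1 hk).1
        _ ≤ _ := by
            rw [← Finset.mul_sum]
            gcongr
            exact sum_inv_le n
    have h3 : K0 * (n * |H n|) ≤ K0 * K2 := by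
      gcongr
      have := hH2 n hn
      rw [le_div_iff₀ (by linarith)] at this
      linarith
    have hs1 : 1 ≤ Real.sqrt n := by rw [Real.one_le_sqrt]; exact hn'
    have hs : Real.sqrt n * Real.sqrt n = n := Real.mul_self_sqrt (by linarith)
    unfold dec
    rw [mul_one_div, le_div_iff₀ (by positivity)]
    have h5 : Real.sqrt n * (|X n| * (n * Real.sqrt n))
        ≤ Real.sqrt n * (K0 + K0 * K2 + 4 * K2) := by
      have e : Real.sqrt n * (|X n| * (n * Real.sqrt n)) = (n:ℝ) ^ 2 * |X n| := by
        calc _ = (Real.sqrt n * Real.sqrt n) * n * |X n| := by ring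
          _ = _ := by rw [hs]; ring
      rw [e]
      have : K0 + K0 * K2 ≤ Real.sqrt n * (K0 + K0 * K2) := by
        have : 0 ≤ K0 + K0 * K2 := by positivity
        nlinarith
      linarith
    exact le_of_mul_le_mul_left h5 (by linarith)
  obtain ⟨K3, hK3def⟩ : ∃ K3, K3 = K0 + K0 * K2 + 4 * K2 := ⟨_, rfl⟩
  rw [← hK3def] at hX2
  have hK3 : 0 ≤ K3 := by rw [hK3def]; positivity
  have hvX : ∀ n : ℕ, a n - 1/2 = X n - lam * (-1) ^ n / (2 * n) - (a n - 1/2) ^ 2 := by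
    intro n; rw [hXdef]; ring
  have hv2 : ∀ n : ℕ, 1 ≤ n → (a n - 1/2) ^ 2 ≤ M ^ 2 * (1 / (n:ℝ) ^ 2) := by
    intro n hn
    have := hv n hn
    rw [← sq_abs]
    calc _ ≤ (M / n) ^ 2 := by gcongr
      _ = _ := by ring
  have hdec_succ : ∀ n : ℕ, 1 ≤ n → dec ((n+1 : ℕ) : ℝ) ≤ dec n := by
    intro n hn
    have hn' : (1:ℝ) ≤ n := by exact_mod_cast hn
    have := dec_le (x := n) (y := ((n+1 : ℕ) : ℝ)) (k := 1) hn' (by push_cast; linarith) le_rfl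
      (by push_cast; linarith)
    simpa using this
  have hpair : ∀ n : ℕ, 1 ≤ n → |a n + a (n+1) - 1| ≤ (2 * K3 + |lam| + 2 * M ^ 2 + M) * dec n := by
    intro n hn
    have hn' : (1:ℝ) ≤ n := by exact_mod_cast hn
    have hd := dec_nonneg (by linarith : (0:ℝ) ≤ n)
    have e : a n + a (n+1) - 1 = X n + X (n+1) - lam * (-1) ^ n * (1 / (2 * n * (n+1)))
        - (a n - 1/2) ^ 2 - (a (n+1) - 1/2) ^ 2 := by
      have e1 := hvX n
      have e2 := hvX (n+1)
      have e3 : lam * (-1) ^ n / (2 * (n:ℝ)) + lam * (-1) ^ (n+1) / (2 * ((n+1 : ℕ):ℝ))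
          = lam * (-1) ^ n * (1 / (2 * n * (n+1))) := by
        push_cast; rw [pow_succ]; field_simp; ring
      linarith
    have t1 := hX2 n hn
    have t2 := (hX2 (n+1) (by omega)).trans (mul_le_mul_of_nonneg_left (hdec_succ n hn) hK3)
    have g1 := dec_ge hn'
    have t3 : |lam * (-1) ^ n * (1 / (2 * n * ((n:ℝ)+1)))| ≤ |lam| * dec n := by
      rw [abs_mul, abs_mul, hsgn, mul_one, abs_of_pos (by positivity : (0:ℝ) < 1 / (2 * n * (n+1)))]
      gcongr
      refine le_trans ?_ g1
      gcongr
      nlinarith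
    have t4 : (a n - 1/2) ^ 2 ≤ M ^ 2 * dec n := (hv2 n hn).trans (by gcongr)
    have t5 : (a (n+1) - 1/2) ^ 2 ≤ M ^ 2 * dec n := by
      refine (hv2 (n+1) (by omega)).trans ?_
      gcongr
      refine (dec_ge (by push_cast; linarith)).trans (hdec_succ n hn)
    have t6 : 0 ≤ M * dec n := by positivity
    rw [e]
    rw [abs_le] at t1 t2 t3 ⊢
    have s1 := sq_nonneg (a n - 1/2)
    have s2 := sq_nonneg (a (n+1) - 1/2)
    have r : (2 * K3 + |lam| + 2 * M ^ 2 + M) * dec n = K3 * dec n + K3 * dec n + |lam| * dec n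
      + M ^ 2 * dec n + M ^ 2 * dec n + M * dec n := by ring
    rw [r]
    constructor <;> linarith
  obtain ⟨M', hM'def⟩ : ∃ M', M' = 2 * K3 + |lam| + 2 * M ^ 2 + M := ⟨_, rfl⟩
  rw [← hM'def] at hpair
  have hM' : 0 ≤ M' := by rw [hM'def]; positivity
  obtain ⟨K4, hK4, hE2⟩ := hW2 M' hM' (fun n hn => (hv n hn).trans (by
    gcongr; rw [hM'def]; have : 0 ≤ 2 * K3 + |lam| + 2 * M ^ 2 := by positivity
    linarith)) hpair
  have hHpair : ∀ n : ℕ, 1 ≤ n → |H n + H (n+1)| ≤ (M' * B + M * (2 * K1) + K4) * dec n := by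
    intro n hn
    have hn' : (1:ℝ) ≤ n := by exact_mod_cast hn
    have hd := dec_nonneg (by linarith : (0:ℝ) ≤ n)
    have e : H n + H (n+1) = (a n + a (n+1) - 1) * E n + (a (n+1) - 1/2) * (E (n+1) - E n)
        + (E n + E (n+1) - 2 * C) / 2 := by
      rw [hHdef, hHdef]; ring
    have hinv : (1:ℝ) / ((n+1 : ℕ):ℝ) ≤ 1 / n := by
      gcongr; push_cast; linarith
    have t1 : |(a n + a (n+1) - 1) * E n| ≤ M' * B * dec n := by
      rw [abs_mul]
      calc _ ≤ (M' * dec n) * B := by gcongr; exacts [hpair n hn, hE n hn]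
        _ = _ := by ring
    have t2 : |(a (n+1) - 1/2) * (E (n+1) - E n)| ≤ M * (2 * K1) * dec n := by
      rw [abs_mul]
      have u1 : |a (n+1) - 1/2| ≤ M * (1 / n) := by
        refine (hv (n+1) (by omega)).trans ?_
        rw [div_eq_mul_one_div]; gcongr
      have u2 : |E (n+1) - E n| ≤ 2 * K1 * (1 / n) := by
        have x1 := hE1 n hn
        have x2 : |E (n+1) - C| ≤ K1 * (1 / n) := by
          refine (hE1 (n+1) (by omega)).trans ?_
          rw [div_eq_mul_one_div]; gcongr
        rw [div_eq_mul_one_div] at x1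
        rw [abs_le] at *
        constructor <;> linarith
      calc _ ≤ (M * (1 / n)) * (2 * K1 * (1 / n)) := by gcongr
        _ = M * (2 * K1) * (1 / (n:ℝ) ^ 2) := by field_simp
        _ ≤ _ := by gcongr; exact dec_ge hn'
    have t3 : |(E n + E (n+1) - 2 * C) / 2| ≤ K4 * dec n := by
      rw [abs_div, abs_two]
      linarith [hE2 n hn, abs_nonneg (E n + E (n+1) - 2 * C)]
    rw [e]
    refine (abs_add_le _ _).trans ((add_le_add ((abs_add_le _ _).trans (add_le_add t1 t2)) t3).trans ?_)
    linarith
  obtain ⟨K5, hK5def⟩ : ∃ K5, K5 = M' * B + M * (2 * K1) + K4 := ⟨_, rfl⟩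
  rw [← hK5def] at hHpair
  have hK5 : 0 ≤ K5 := by rw [hK5def]; positivity
  have hS : ∀ n : ℕ, 1 ≤ n → |∑ k ∈ Finset.Ico 1 n, H k| ≤ K5 * (∑' k : ℕ, dec k) + 2 * (B + |C|) := by
    intro n hn
    have e : ∀ n : ℕ, 1 ≤ n →
        ∑ k ∈ Finset.Ico 1 n, (H k + H (k+1)) = 2 * ∑ k ∈ Finset.Ico 1 n, H k - H 1 + H n := by
      intro n hn
      induction n, hn using Nat.le_induction with
      | base => simp
      | succ n hn ih => rw [Finset.sum_Ico_succ_top hn, Finset.sum_Ico_succ_top hn, ih]; ring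
    have h1 : |∑ k ∈ Finset.Ico 1 n, (H k + H (k+1))| ≤ K5 * (∑' k : ℕ, dec k) := by
      refine (Finset.abs_sum_le_sum_abs _ _).trans ?_
      calc _ ≤ ∑ k ∈ Finset.Ico 1 n, K5 * dec k :=
            Finset.sum_le_sum fun k hk => hHpair k (Finset.mem_Ico.1 hk).1
        _ = K5 * ∑ k ∈ Finset.Ico 1 n, dec k := by rw [Finset.mul_sum]
        _ ≤ _ := by
          gcongr
          exact summable_dec.sum_le_tsum _ (fun k _ => dec_nonneg (Nat.cast_nonneg k))
    rw [e n hn] at h1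
    have h2 := hH1 1 le_rfl
    have h3 := hH1 n hn
    rw [abs_le] at *
    constructor <;> linarith
  obtain ⟨K6, hK6⟩ : ∃ K6, K6 = K0 + K0 * K2 + (K5 * (∑' k : ℕ, dec k) + 2 * (B + |C|)) := ⟨_, rfl⟩
  refine ⟨K6 + M ^ 2, fun n hn => ?_⟩
  have hn' : (1:ℝ) ≤ n := by exact_mod_cast hn
  have h1 := hmain n hn
  have h2 := hS n hn
  have h3 : K0 * (n * |H n|) ≤ K0 * K2 := by
    gcongr
    have := hH2 n hn
    rw [le_div_iff₀ (by linarith)] at this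
    linarith
  have h4 : |X n| ≤ K6 * (1 / (n:ℝ) ^ 2) := by
    rw [mul_one_div, le_div_iff₀ (by positivity)]
    linarith
  have h5 := hv2 n hn
  have e : a n - (1/2 + (-1) ^ (n+1) * lam / (2 * n)) = X n - (a n - 1/2) ^ 2 := by
    have := hvX n
    have e2 : (-1 : ℝ) ^ (n+1) * lam / (2 * n) = -(lam * (-1) ^ n / (2 * n)) := by
      rw [pow_succ]; ring
    rw [e2]; linarith
  rw [e]
  refine (abs_sub _ _).trans ?_
  rw [abs_of_nonneg (sq_nonneg (a n - 1/2))]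
  refine (add_le_add h4 h5).trans (le_of_eq ?_)
  ring
/-! ### Algebra of the orthonormal polynomials -/

open Polynomial in
/-- Orthonormal system for an even moment functional. -/
structure OP (L : Polynomial ℝ →ₗ[ℝ] ℝ) (p : ℕ → Polynomial ℝ) : Prop where
  hdeg : ∀ n, (p n).degree = n
  hlead : ∀ n, 0 < (p n).coeff n
  horth : ∀ m n, L (p m * p n) = if m = n then 1 else 0
  heven : ∀ q, L (q.comp (-X)) = L q

section
open Polynomial

variable {L : Polynomial ℝ →ₗ[ℝ] ℝ} {p : ℕ → Polynomial ℝ}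

lemma OP.coeff_gt (O : OP L p) {n k : ℕ} (h : n < k) : (p n).coeff k = 0 :=
  coeff_eq_zero_of_degree_lt (by rw [O.hdeg]; exact_mod_cast h)

lemma OP.L_C_mul (L : Polynomial ℝ →ₗ[ℝ] ℝ) (c : ℝ) (q : Polynomial ℝ) : L (C c * q) = c * L q := by
  rw [← smul_eq_C_mul, map_smul, smul_eq_mul]

lemma OP.orth_lt (O : OP L p) (n : ℕ) : ∀ d ≤ n, ∀ q : Polynomial ℝ, (∀ m, d ≤ m → q.coeff m = 0) →
    L (q * p n) = 0 := by
  intro d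
  induction d with
  | zero =>
    intro _ q hq
    have : q = 0 := by ext m; simpa using hq m (Nat.zero_le _)
    simp [this]
  | succ d ih =>
    intro hd q hq
    have hl := O.hlead d
    have h1 := ih (by omega) (q - C (q.coeff d / (p d).coeff d) * p d) (by
      intro m hm
      rw [coeff_sub, coeff_C_mul]
      rcases eq_or_lt_of_le hm with h | h
      · subst h; field_simp; ring
      · rw [hq m h, O.coeff_gt h]; ring)
    rw [sub_mul, map_sub, mul_assoc, OP.L_C_mul, O.horth, if_neg (by omega), mul_zero, sub_zero] at h1
    exact h1

lemma OP.orth_eq (O : OP L p) (n : ℕ) (q : Polynomial ℝ) (hq : ∀ m, n < m → q.coeff m = 0) :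
    L (q * p n) = q.coeff n / (p n).coeff n := by
  have hl := O.hlead n
  have h1 := O.orth_lt n n le_rfl (q - C (q.coeff n / (p n).coeff n) * p n) (by
      intro m hm
      rw [coeff_sub, coeff_C_mul]
      rcases eq_or_lt_of_le hm with h | h
      · subst h; field_simp; ring
      · rw [hq m h, O.coeff_gt h]; ring)
  rw [sub_mul, map_sub, mul_assoc, OP.L_C_mul, O.horth, if_pos rfl, mul_one, sub_eq_zero] at h1
  exact h1

lemma OP.eq_zero (O : OP L p) (d : ℕ) (q : Polynomial ℝ) (hq : ∀ m, d ≤ m → q.coeff m = 0)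
    (h : ∀ k < d, L (q * p k) = 0) : q = 0 := by
  by_contra hne
  have hk : q.natDegree < d := by
    by_contra hk
    exact hne (leadingCoeff_eq_zero.1 (hq q.natDegree (not_lt.1 hk)))
  have h1 := h _ hk
  rw [O.orth_eq _ q (fun m hm => coeff_eq_zero_of_natDegree_lt hm), div_eq_zero_iff] at h1
  rcases h1 with h1 | h1
  · exact hne (leadingCoeff_eq_zero.1 h1)
  · exact (O.hlead _).ne' h1

lemma coeff_comp_neg (q : Polynomial ℝ) (k : ℕ) : (q.comp (-X)).coeff k = (-1) ^ k * q.coeff k := by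
  have : (-X : Polynomial ℝ) = C (-1) * X := by simp
  rw [this, comp_C_mul_X_coeff]; ring

lemma OP.parity (O : OP L p) (n : ℕ) : (p n).comp (-X) = C ((-1) ^ n) * p n := by
  have h := O.eq_zero n ((p n).comp (-X) - C ((-1) ^ n) * p n) (by
    intro m hm
    rw [coeff_sub, coeff_comp_neg, coeff_C_mul]
    rcases eq_or_lt_of_le hm with h | h
    · subst h; ring
    · rw [O.coeff_gt h]; ring) (by
    intro k hk
    rw [sub_mul, map_sub, mul_assoc, OP.L_C_mul, O.horth, if_neg (by omega), mul_zero, sub_zero]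
    rw [← O.heven, mul_comp, comp_assoc]
    have : (-X : Polynomial ℝ).comp (-X) = X := by simp
    rw [this, comp_X, mul_comm]
    apply O.orth_lt n n le_rfl
    intro m hm
    rw [coeff_comp_neg, O.coeff_gt (by omega), mul_zero])
  exact sub_eq_zero.1 h

lemma OP.coeff_odd (O : OP L p) {n k : ℕ} (h : Odd (n + k)) : (p n).coeff k = 0 := by
  have h1 := congrArg (fun q => q.coeff k) (O.parity n)
  simp only [coeff_comp_neg, coeff_C_mul] at h1
  have h2 : (-1:ℝ) ^ n * (-1) ^ k = -1 := by rw [← pow_add]; exact h.neg_one_pow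
  have h3 : (-1:ℝ) ^ n * (-1) ^ n = 1 := by rw [← pow_add]; exact (Even.neg_one_pow ⟨n, rfl⟩)
  have h4 : (-1:ℝ) ^ n * ((-1) ^ k * (p n).coeff k) = (-1:ℝ) ^ n * ((-1) ^ n * (p n).coeff k) := by
    rw [h1]
  rw [← mul_assoc, ← mul_assoc, h2, h3] at h4
  linarith

lemma OP.b_zero (O : OP L p) (n : ℕ) : L (X * p n * p n) = 0 := by
  have h := O.heven (X * p n * p n)
  rw [mul_comp, mul_comp, O.parity, X_comp] at h
  have h3 : (-1:ℝ) ^ n * (-1) ^ n = 1 := by rw [← pow_add]; exact (Even.neg_one_pow ⟨n, rfl⟩)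
  have e : -X * (C ((-1:ℝ) ^ n) * p n) * (C ((-1) ^ n) * p n) = C (-1 : ℝ) * (X * p n * p n) := by
    calc _ = -(C ((-1:ℝ) ^ n) * C ((-1) ^ n)) * (X * p n * p n) := by ring
      _ = _ := by rw [← C_mul, h3]; simp
  rw [e, OP.L_C_mul] at h
  linarith

/-- recurrence coefficients -/
noncomputable def ac (L : Polynomial ℝ →ₗ[ℝ] ℝ) (p : ℕ → Polynomial ℝ) (n : ℕ) : ℝ :=
  L (X * p n * p (n-1))

lemma OP.ac_eq (O : OP L p) (n : ℕ) : ac L p (n+1) = (p n).coeff n / (p (n+1)).coeff (n+1) := by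
  unfold ac
  rw [Nat.add_sub_cancel, mul_right_comm, O.orth_eq]
  · rw [coeff_X_mul]
  · intro m hm
    obtain ⟨m, rfl⟩ : ∃ k, m = k + 1 := ⟨m - 1, by omega⟩
    rw [coeff_X_mul, O.coeff_gt (by omega)]

lemma OP.ac_pos (O : OP L p) (n : ℕ) : 0 < ac L p (n+1) := by
  rw [O.ac_eq]; exact div_pos (O.hlead _) (O.hlead _)

lemma OP.coeff_X_mul_gt (O : OP L p) {n m : ℕ} (h : n + 1 < m) : (X * p n).coeff m = 0 := by
  obtain ⟨m, rfl⟩ : ∃ k, m = k + 1 := ⟨m - 1, by omega⟩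
  rw [coeff_X_mul, O.coeff_gt (by omega)]

lemma OP.three (O : OP L p) (n : ℕ) :
    X * p (n+1) = C (ac L p (n+2)) * p (n+2) + C (ac L p (n+1)) * p n := by
  rw [← sub_eq_zero]
  apply O.eq_zero (n+3)
  · intro m hm
    rw [coeff_sub, coeff_add, O.coeff_X_mul_gt (by omega), coeff_C_mul, coeff_C_mul,
      O.coeff_gt (by omega), O.coeff_gt (by omega)]; ring
  · intro k hk
    rw [sub_mul, add_mul, map_sub, map_add, mul_assoc (C _), mul_assoc (C _), OP.L_C_mul, OP.L_C_mul,
      O.horth, O.horth]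
    rcases lt_trichotomy k (n+1) with h | h | h
    · rcases Nat.lt_succ_iff_lt_or_eq.1 h with h' | h'
      · rw [if_neg (by omega), if_neg (by omega), mul_right_comm, O.orth_lt (n+1) (n+1) le_rfl]
        · ring
        · intro m hm; exact O.coeff_X_mul_gt (by omega)
      · subst h'
        rw [if_neg (by omega), if_pos rfl]; unfold ac; rw [Nat.add_sub_cancel]; ring
    · subst h
      rw [O.b_zero, if_neg (by omega), if_neg (by omega)]; ring
    · obtain rfl : k = n + 2 := by omega
      rw [if_pos rfl, if_neg (by omega)]; unfold ac
      rw [show n + 2 - 1 = n + 1 by omega, mul_right_comm]; ring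

lemma OP.three_zero (O : OP L p) : X * p 0 = C (ac L p 1) * p 1 := by
  rw [← sub_eq_zero]
  apply O.eq_zero 2
  · intro m hm
    rw [coeff_sub, O.coeff_X_mul_gt (by omega), coeff_C_mul, O.coeff_gt (by omega)]; ring
  · intro k hk
    rw [sub_mul, map_sub, mul_assoc (C _), OP.L_C_mul, O.horth]
    rcases Nat.lt_succ_iff_lt_or_eq.1 hk with h | h
    · obtain rfl : k = 0 := by omega
      rw [O.b_zero, if_neg (by omega)]; ring
    · subst h
      rw [if_pos rfl]; unfold ac
      rw [Nat.sub_self, mul_right_comm]; ring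

/-- second coefficient -/
noncomputable def sg (p : ℕ → Polynomial ℝ) (n : ℕ) : ℝ := -(X ^ 2 * p n).coeff n / (p n).coeff n

lemma OP.sg_succ (O : OP L p) (n : ℕ) : sg p (n+2) = sg p (n+1) + ac L p (n+1) ^ 2 := by
  have h := congrArg (fun q => (X * q).coeff (n+1)) (O.three n)
  simp only [coeff_X_mul, mul_add, coeff_add, coeff_C_mul] at h
  have e1 : (X ^ 2 * p (n+1)).coeff (n+1) = (X * p (n+1)).coeff n := by
    rw [pow_two, mul_assoc, coeff_X_mul]
  have e2 : (X ^ 2 * p (n+2)).coeff (n+2) = (p (n+2)).coeff n := by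
    rw [pow_two, mul_assoc, coeff_X_mul, coeff_X_mul]
  unfold sg
  rw [e1, e2, h, O.ac_eq, O.ac_eq]
  have h0 := (O.hlead n).ne'
  have h1 := (O.hlead (n+1)).ne'
  have h2 := (O.hlead (n+2)).ne'
  field_simp
  ring

lemma OP.L1 (O : OP L p) (n : ℕ) : L (derivative (p (n+1)) * p n) = (n+1) / ac L p (n+1) := by
  rw [O.orth_eq, O.ac_eq, coeff_derivative]
  · rw [div_div_eq_mul_div, mul_comm]
  · intro m hm; rw [coeff_derivative, O.coeff_gt (by omega), zero_mul]

lemma OP.L2 (O : OP L p) (n : ℕ) : L (p (n+1) * derivative (p n)) = 0 := by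
  rw [mul_comm]
  apply O.orth_lt (n+1) (n+1) le_rfl
  intro m hm; rw [coeff_derivative, O.coeff_gt (by omega), zero_mul]

lemma OP.L3 (O : OP L p) (n : ℕ) :
    L (X ^ 2 * (p (n+1) * derivative (p n))) = n * ac L p (n+1) := by
  rw [mul_left_comm, mul_comm (p (n+1)), O.orth_eq, O.ac_eq]
  · cases n with
    | zero =>
      rw [pow_two, mul_assoc, coeff_X_mul, coeff_X_mul_zero]; simp
    | succ n =>
      rw [pow_two, mul_assoc, coeff_X_mul, coeff_X_mul, coeff_derivative]; push_cast; ring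
  · intro m hm
    obtain ⟨m, rfl⟩ : ∃ k, m = k + 2 := ⟨m - 2, by omega⟩
    rw [pow_two, mul_assoc, coeff_X_mul, coeff_X_mul, coeff_derivative, O.coeff_gt (by omega), zero_mul]

lemma coeff_X_mul_derivative (q : Polynomial ℝ) (m : ℕ) :
    (X * derivative q).coeff m = m * q.coeff m := by
  cases m with
  | zero => simp
  | succ m => rw [coeff_X_mul, coeff_derivative]; push_cast; ring

lemma OP.L4 (O : OP L p) (n : ℕ) :
    L (X ^ 2 * (derivative (p (n+1)) * p n)) = (n+1) * ac L p (n+1) + 2 * sg p (n+1) / ac L p (n+1) := by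
  have e : X ^ 2 * (derivative (p (n+1)) * p n) = C ((n:ℝ)+1) * (X * p (n+1) * p n) +
      (X * (X * derivative (p (n+1)) - C ((n:ℝ)+1) * p (n+1))) * p n := by ring
  have e2 : L (X * p (n+1) * p n) = ac L p (n+1) := by unfold ac; rw [Nat.add_sub_cancel]
  rw [e, map_add, OP.L_C_mul, e2, O.orth_eq]
  · congr 1
    rw [O.ac_eq]
    unfold sg
    have h0 := (O.hlead n).ne'
    have h1 := (O.hlead (n+1)).ne'
    cases n with
    | zero =>
      rw [coeff_X_mul_zero, pow_two, mul_assoc, coeff_X_mul, coeff_X_mul_zero]; simp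
    | succ n =>
      rw [coeff_X_mul, coeff_sub, coeff_X_mul_derivative, coeff_C_mul, pow_two, mul_assoc, coeff_X_mul,
        coeff_X_mul]
      push_cast
      field_simp
      ring
  · intro m hm
    obtain ⟨m, rfl⟩ : ∃ k, m = k + 1 := ⟨m - 1, by omega⟩
    rw [coeff_X_mul, coeff_sub, coeff_X_mul_derivative, coeff_C_mul]
    rcases eq_or_lt_of_le (Nat.lt_succ_iff.1 hm) with h | h
    · subst h
      rw [O.coeff_odd ⟨n, by ring⟩]; ring
    · rcases eq_or_lt_of_le (Nat.succ_le_of_lt h) with h' | h'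
      · rw [← h']; push_cast; ring
      · rw [O.coeff_gt (by omega)]; ring

lemma OP.L5 (O : OP L p) (n : ℕ) : ∃ R : Polynomial ℝ, X * R = p (n+1) * p n ∧
    L R = (1 - (-1) ^ (n+1)) / 2 / ac L p (n+1) := by
  have key : ∀ q : Polynomial ℝ, q.coeff 0 = 0 → X * q.divX = q := by
    intro q hq
    have := X_mul_divX_add q
    rw [hq] at this; simpa using this
  rcases Nat.even_or_odd n with h | h
  · refine ⟨(p (n+1)).divX * p n, ?_, ?_⟩
    · rw [← mul_assoc, key]
      exact O.coeff_odd (by rw [add_zero]; exact h.add_one)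
    · rw [O.orth_eq, coeff_divX, O.ac_eq, h.add_one.neg_one_pow]
      · rw [div_div_eq_mul_div]; norm_num
      · intro m hm; rw [coeff_divX, O.coeff_gt (by omega)]
  · refine ⟨(p n).divX * p (n+1), ?_, ?_⟩
    · rw [← mul_assoc, key, mul_comm]
      exact O.coeff_odd (by rw [add_zero]; exact h)
    · rw [O.orth_lt (n+1) (n+1) le_rfl, h.add_one.neg_one_pow]
      · simp
      · intro m hm; rw [coeff_divX, O.coeff_gt (by omega)]

/-- The Laguerre-Freud type relation. -/
lemma OP.relation (O : OP L p) (α lam : ℝ) (Eg : Polynomial ℝ → ℝ)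
    (ibp : ∀ q R : Polynomial ℝ, X * R = q →
      L (C (-(2 + 2 * α + 2 * lam)) * (X * q) + derivative q - X ^ 2 * derivative q
        + C (2 * lam) * R) + Eg q = 0) (n : ℕ) :
    ((n:ℝ) + 1) - 2 * sg p (n+1) + lam * (1 - (-1) ^ (n+1)) + ac L p (n+1) * Eg (p (n+1) * p n)
      = (2 * ((n:ℝ)+1) + 1 + (2 * α + 2 * lam)) * ac L p (n+1) ^ 2 := by
  obtain ⟨R, hR, hLR⟩ := O.L5 n
  have h := ibp _ R hR
  have hd : derivative (p (n+1) * p n) = derivative (p (n+1)) * p n + p (n+1) * derivative (p n) := by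
    rw [derivative_mul]
  have e2 : L (X * (p (n+1) * p n)) = ac L p (n+1) := by
    unfold ac; rw [Nat.add_sub_cancel, mul_assoc]
  rw [map_add, map_sub, map_add, OP.L_C_mul, OP.L_C_mul, e2, hLR, hd, mul_add, map_add, map_add,
    O.L1, O.L2, O.L3, O.L4] at h
  have ha := (O.ac_pos n).ne'
  have hkey : ac L p (n+1) * (-(2 + 2 * α + 2 * lam) * ac L p (n + 1) + ((n + 1) / ac L p (n + 1) + 0) -
      ((n + 1) * ac L p (n + 1) + 2 * sg p (n + 1) / ac L p (n + 1) + n * ac L p (n + 1)) +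
      2 * lam * ((1 - (-1) ^ (n + 1)) / 2 / ac L p (n + 1)) + Eg (p (n+1) * p n)) = 0 := by
    rw [h, mul_zero]
  field_simp at hkey
  linear_combination hkey

/-- integer-indexed polynomials -/
noncomputable def PZ (p : ℕ → Polynomial ℝ) (n : ℤ) : Polynomial ℝ := if 0 ≤ n then p n.toNat else 0

/-- integer-indexed recurrence coefficients -/
noncomputable def AZ (L : Polynomial ℝ →ₗ[ℝ] ℝ) (p : ℕ → Polynomial ℝ) (n : ℤ) : ℝ :=
  if 1 ≤ n then ac L p n.toNat else 0

lemma OP.threeZ (O : OP L p) (n : ℤ) :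
    X * PZ p n = C (AZ L p (n+1)) * PZ p (n+1) + C (AZ L p n) * PZ p (n-1) := by
  unfold PZ AZ
  rcases lt_trichotomy n 0 with h | h | h
  · rw [if_neg (by omega : ¬ 0 ≤ n), if_neg (by omega : ¬ 1 ≤ n+1), if_neg (by omega : ¬ 1 ≤ n)]; simp
  · subst h; simpa using O.three_zero
  · obtain ⟨k, rfl⟩ : ∃ k : ℕ, n = ((k+1 : ℕ) : ℤ) := ⟨n.toNat - 1, by omega⟩
    rw [if_pos (by omega), if_pos (by omega), if_pos (by omega), if_pos (by omega), if_pos (by omega)]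
    have e1 : (((k+1 : ℕ) : ℤ) + 1).toNat = k + 2 := by omega
    have e2 : (((k+1 : ℕ) : ℤ) - 1).toNat = k := by omega
    rw [e1, e2, Int.toNat_natCast, O.three]

lemma OP.wave (O : OP L p)
    (hT : ∀ q : Polynomial ℝ, (∀ x ∈ Set.Icc (-1:ℝ) 1, |q.eval x| ≤ 1) → ∀ n m,
      |L (q * (p n * p m))| ≤ 1) :
    Wave (AZ L p) (fun k n m => L (Chebyshev.T ℝ k * (PZ p n * PZ p m))) where
  h0 := by
    intro n m hm
    simp only [Nat.cast_zero, Chebyshev.T_zero, one_mul]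
    unfold PZ
    by_cases hn : 0 ≤ n
    · rw [if_pos hn, if_pos hm, O.horth]
      have : n.toNat = m.toNat ↔ n = m := by omega
      simp only [this]
    · rw [if_neg hn, zero_mul, map_zero, if_neg (by omega)]
  h1 := by
    intro n m hm
    simp only [Nat.cast_one, Nat.cast_zero, Chebyshev.T_zero, Chebyshev.T_one, one_mul]
    rw [← mul_assoc, O.threeZ, add_mul, map_add, mul_assoc, mul_assoc, OP.L_C_mul, OP.L_C_mul]
  h2 := by
    intro k n m hm
    have e : ((k + 2 : ℕ) : ℤ) = (k:ℤ) + 2 := by push_cast; ring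
    have e' : ((k + 1 : ℕ) : ℤ) = (k:ℤ) + 1 := by push_cast; ring
    simp only [e, e']
    rw [Chebyshev.T_add_two]
    have : (2 * X * Chebyshev.T ℝ ((k:ℤ) + 1) - Chebyshev.T ℝ k) * (PZ p n * PZ p m)
        = C 2 * (Chebyshev.T ℝ ((k:ℤ) + 1) * ((X * PZ p n) * PZ p m))
          - Chebyshev.T ℝ k * (PZ p n * PZ p m) := by
      rw [show (C (2:ℝ) : Polynomial ℝ) = 2 from rfl]; ring
    rw [this, O.threeZ, map_sub, OP.L_C_mul]
    have : Chebyshev.T ℝ ((k:ℤ) + 1) * ((C (AZ L p (n+1)) * PZ p (n+1) + C (AZ L p n) * PZ p (n-1))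
        * PZ p m) = C (AZ L p (n+1)) * (Chebyshev.T ℝ ((k:ℤ) + 1) * (PZ p (n+1) * PZ p m))
        + C (AZ L p n) * (Chebyshev.T ℝ ((k:ℤ) + 1) * (PZ p (n-1) * PZ p m)) := by ring
    rw [this, map_add, OP.L_C_mul, OP.L_C_mul]
    ring
  hb := by
    intro k n m hm
    unfold PZ
    by_cases hn : 0 ≤ n
    · rw [if_pos hn, if_pos hm]
      apply hT
      intro x hx
      rw [← Real.cos_arccos hx.1 hx.2, Chebyshev.T_real_cos]
      exact Real.abs_cos_le_one _
    · rw [if_neg hn]; simp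
  hneg := by
    intro k n m hn
    unfold PZ
    rw [if_neg (by omega)]; simp

end
/-! ### Combination of algebra, wave equation and bootstrap -/

section
open Polynomial

variable {L : Polynomial ℝ →ₗ[ℝ] ℝ} {p : ℕ → Polynomial ℝ}

lemma AZ_bound1 (M : ℝ) (hM : 0 ≤ M)
    (h : ∀ n : ℕ, 1 ≤ n → |ac L p n - 1/2| ≤ M / n) :
    ∀ j : ℤ, 0 ≤ j → |AZ L p j - 1/2| ≤ (4*M+4) / (1 + j) := by
  intro j hj
  unfold AZ
  by_cases h1 : 1 ≤ j
  · obtain ⟨n, rfl⟩ : ∃ n : ℕ, j = (n : ℤ) := ⟨j.toNat, by omega⟩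
    have hn : 1 ≤ n := by exact_mod_cast h1
    have hn' : (1:ℝ) ≤ n := by exact_mod_cast hn
    rw [if_pos h1, Int.toNat_natCast]
    refine (h n hn).trans ?_
    rw [Int.cast_natCast, div_le_div_iff₀ (by linarith) (by linarith)]
    nlinarith
  · have : j = 0 := by omega
    subst this
    simp
    linarith

lemma AZ_bound2 (M : ℝ) (hM : 0 ≤ M)
    (h1 : ∀ n : ℕ, 1 ≤ n → |ac L p n - 1/2| ≤ M / n)
    (h : ∀ n : ℕ, 1 ≤ n → |ac L p n + ac L p (n+1) - 1| ≤ M * dec n) :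
    ∀ j : ℤ, 0 ≤ j → |AZ L p j + AZ L p (j+1) - 1| ≤ (4*M+4) * dec (1 + j) := by
  intro j hj
  unfold AZ
  by_cases h2 : 1 ≤ j
  · obtain ⟨n, rfl⟩ : ∃ n : ℕ, j = (n : ℤ) := ⟨j.toNat, by omega⟩
    have hn : 1 ≤ n := by exact_mod_cast h2
    have hn' : (1:ℝ) ≤ n := by exact_mod_cast hn
    have e : ((n:ℤ)+1).toNat = n + 1 := by omega
    rw [if_pos h2, if_pos (by omega), Int.toNat_natCast, e]
    refine (h n hn).trans ?_
    rw [Int.cast_natCast]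
    have := dec_le (x := 1 + n) (y := n) (k := 2) (by linarith) hn' (by norm_num) (by linarith)
    have h0 := dec_nonneg (x := 1 + n) (by linarith)
    nlinarith
  · have : j = 0 := by omega
    subst this
    have := h1 1 le_rfl
    simp at this ⊢
    unfold dec
    simp
    rw [abs_le] at *
    constructor <;> linarith

theorem OP.final (O : OP L p) (α lam : ℝ) (Eg : Polynomial ℝ → ℝ)
    (hT : ∀ q : Polynomial ℝ, (∀ x ∈ Set.Icc (-1:ℝ) 1, |q.eval x| ≤ 1) → ∀ n m,
      |L (q * (p n * p m))| ≤ 1)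
    (ibp : ∀ q R : Polynomial ℝ, X * R = q →
      L (C (-(2+2*α+2*lam)) * (X*q) + derivative q - X^2 * derivative q + C (2*lam) * R) + Eg q = 0)
    (B : ℝ) (hB : ∀ n, |Eg (p (n+1) * p n)| ≤ B)
    (c : ℤ → ℝ) (hc : Summable (fun k : ℤ => |c k| * (1 + |(k:ℝ)|) ^ 6))
    (hE : ∀ q : Polynomial ℝ, HasSum (fun k : ℤ => c k * L (Chebyshev.T ℝ k * q)) (Eg q)) :
    ∃ K, ∀ n : ℕ, n ≥ 1 → |ac L p n - (1/2 + (-1)^(n+1)*lam/(2*n))| ≤ K/(n:ℝ)^2 := by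
  have W := O.wave hT
  have hE' : ∀ m : ℤ, 0 ≤ m → HasSum (fun k : ℤ => c k *
      L (Chebyshev.T ℝ k.natAbs * (PZ p (m+1) * PZ p m))) (Eg (PZ p (m+1) * PZ p m)) := by
    intro m hm
    have := hE (PZ p (m+1) * PZ p m)
    simpa only [Chebyshev.T_natAbs] using this
  have ePZ : ∀ n : ℕ, PZ p n = p n := by
    intro n; unfold PZ; rw [if_pos (by omega), Int.toNat_natCast]
  have ePZ' : ∀ n : ℕ, PZ p ((n:ℤ)+1) = p (n+1) := by
    intro n; have := ePZ (n+1); push_cast at this; exact this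
  set S := ∑' k : ℤ, |c k| * (1 + |(k:ℝ)|) ^ 6 with hS
  have hS0 : 0 ≤ S := tsum_nonneg (fun k => by positivity)
  apply bootstrap (ac L p) (fun n => Eg (p n * p (n-1))) (sg p) (2*α+2*lam) lam
    (∑' k : ℤ, c k * fr k.natAbs 1 0) B
  · intro n hn
    obtain ⟨k, rfl⟩ : ∃ k, n = k + 1 := ⟨n - 1, by omega⟩
    exact O.ac_pos k
  · intro n hn
    have := hT X (by intro x hx; rw [eval_X, abs_le]; exact hx) n (n-1)
    unfold ac
    rw [mul_assoc]
    exact (le_abs_self _).trans this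
  · intro n hn
    obtain ⟨k, rfl⟩ : ∃ k, n = k + 1 := ⟨n - 1, by omega⟩
    exact hB k
  · intro n hn
    obtain ⟨k, rfl⟩ : ∃ k, n = k + 1 := ⟨n - 1, by omega⟩
    exact O.sg_succ k
  · intro n hn
    obtain ⟨k, rfl⟩ : ∃ k, n = k + 1 := ⟨n - 1, by omega⟩
    have := O.relation α lam Eg ibp k
    rw [Nat.add_sub_cancel]
    push_cast
    exact this
  · intro M hM h1
    refine ⟨S * (4 * (4*M+4)), by positivity, ?_⟩
    intro n hn
    obtain ⟨k, rfl⟩ : ∃ k, n = k + 1 := ⟨n - 1, by omega⟩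
    have := W.E_bound (by positivity) (AZ_bound1 M hM h1) c hc _ hE' k (by omega)
    simp only [ePZ, ePZ', Int.cast_natCast] at this
    rw [Nat.add_sub_cancel]
    refine this.trans (le_of_eq ?_)
    push_cast
    rw [add_comm (1:ℝ), hS]
    ring
  · intro M hM h1 h2
    refine ⟨S * (4 * (4*M+4) + 32 * (4*M+4)^2), by positivity, ?_⟩
    intro n hn
    obtain ⟨k, rfl⟩ : ∃ k, n = k + 1 := ⟨n - 1, by omega⟩
    have := W.S_bound (by positivity) (AZ_bound1 M hM h1) (AZ_bound2 M hM h1 h2) c hc _ hE' k (by omega)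
    have e2 : PZ p ((k:ℤ)+1+1) = p (k+1+1) := by
      have := ePZ (k+1+1); push_cast at this; exact this
    simp only [ePZ, ePZ', e2, Int.cast_natCast] at this
    rw [Nat.add_sub_cancel, Nat.add_sub_cancel]
    refine this.trans (le_of_eq ?_)
    push_cast
    rw [add_comm (1:ℝ)]
    ring

end

/-! ### Analysis of the weight -/

section
open Polynomial
open scoped Topology

/-- The hypotheses on the weight. -/
structure Wt (α lam : ℝ) (h w : ℝ → ℝ) : Prop where
  hα : -1 < α
  hlam : -1 < 2 * lam
  hev : ∀ t ∈ Set.Icc (-1 : ℝ) 1, h (-t) = h t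
  han : ∀ t ∈ Set.Icc (-1 : ℝ) 1, AnalyticAt ℝ h t
  hpos : ∀ t ∈ Set.Icc (-1 : ℝ) 1, 0 < h t
  hw : ∀ t ∈ Set.Ioo (-1 : ℝ) 1, w t = (1 - t ^ 2) ^ α * h t * |t| ^ (2 * lam)
  hint : IntegrableOn w (Set.Ioo (-1 : ℝ) 1)

variable {α lam : ℝ} {h w : ℝ → ℝ}

lemma one_sub_sq_pos {t : ℝ} (ht : t ∈ Set.Ioo (-1:ℝ) 1) : 0 < 1 - t ^ 2 := by
  nlinarith [ht.1, ht.2]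

lemma Wt.nonneg (H : Wt α lam h w) {t : ℝ} (ht : t ∈ Set.Ioo (-1:ℝ) 1) : 0 ≤ w t := by
  rw [H.hw t ht]
  have := one_sub_sq_pos ht
  have := H.hpos t (Set.Ioo_subset_Icc_self ht)
  positivity

lemma Wt.even (H : Wt α lam h w) {t : ℝ} (ht : t ∈ Set.Ioo (-1:ℝ) 1) : w (-t) = w t := by
  rw [H.hw t ht, H.hw (-t) ⟨by linarith [ht.2], by linarith [ht.1]⟩,
    H.hev t (Set.Ioo_subset_Icc_self ht), abs_neg, neg_sq]

lemma Wt.cint (H : Wt α lam h w) {f : ℝ → ℝ} (hf : ContinuousOn f (Set.Icc (-1) 1)) :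
    IntegrableOn (fun t => f t * w t) (Set.Ioo (-1:ℝ) 1) :=
  H.hint.continuousOn_mul_of_subset hf isCompact_Icc measurableSet_Ioo Set.Ioo_subset_Icc_self

/-- the logarithmic derivative part -/
noncomputable def gg (h : ℝ → ℝ) (t : ℝ) : ℝ := (1 - t ^ 2) * deriv h t / h t

lemma Wt.gg_an (H : Wt α lam h w) {t : ℝ} (ht : t ∈ Set.Icc (-1:ℝ) 1) : AnalyticAt ℝ (gg h) t := by
  unfold gg
  have h1 := H.han t ht
  refine AnalyticAt.div (AnalyticAt.mul ?_ h1.deriv) h1 (H.hpos t ht).ne'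
  fun_prop

lemma Wt.gg_cont (H : Wt α lam h w) : ContinuousOn (gg h) (Set.Icc (-1) 1) :=
  fun _ ht => (H.gg_an ht).continuousAt.continuousWithinAt

lemma Wt.gg_cos (H : Wt α lam h w) : ContDiff ℝ (⊤ : ℕ∞) (fun θ => gg h (Real.cos θ)) := by
  rw [contDiff_iff_contDiffAt]
  intro θ
  have := (H.gg_an (Real.cos_mem_Icc θ)).contDiffAt (n := (⊤ : ℕ∞))
  exact this.comp θ Real.contDiff_cos.contDiffAt

/-- moment functional -/
noncomputable def Wt.L (H : Wt α lam h w) : Polynomial ℝ →ₗ[ℝ] ℝ where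
  toFun q := ∫ t in Set.Ioo (-1 : ℝ) 1, q.eval t * w t
  map_add' q r := by
    rw [← integral_add (H.cint q.continuousOn) (H.cint r.continuousOn)]
    congr 1; ext t; rw [eval_add]; ring
  map_smul' c q := by
    rw [RingHom.id_apply, smul_eq_mul, ← integral_const_mul]
    congr 1; ext t; rw [eval_smul, smul_eq_mul]; ring

lemma Wt.L_apply (H : Wt α lam h w) (q : Polynomial ℝ) :
    H.L q = ∫ t in Set.Ioo (-1 : ℝ) 1, q.eval t * w t := rfl

noncomputable def Wt.Eg (_H : Wt α lam h w) (q : Polynomial ℝ) : ℝ :=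
  ∫ t in Set.Ioo (-1 : ℝ) 1, gg h t * q.eval t * w t

lemma integral_Ioo_eq (f : ℝ → ℝ) :
    ∫ t in Set.Ioo (-1 : ℝ) 1, f t = ∫ t in (-1:ℝ)..1, f t := by
  rw [intervalIntegral.integral_of_le (by norm_num), integral_Ioc_eq_integral_Ioo]

lemma Wt.L_even (H : Wt α lam h w) (q : Polynomial ℝ) : H.L (q.comp (-X)) = H.L q := by
  rw [H.L_apply, H.L_apply]
  have : ∫ t in Set.Ioo (-1 : ℝ) 1, (q.comp (-X)).eval t * w t
      = ∫ t in Set.Ioo (-1 : ℝ) 1, (fun s => q.eval s * w s) (-t) := by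
    apply setIntegral_congr_fun measurableSet_Ioo
    intro t ht
    simp only [eval_comp, eval_neg, eval_X]
    rw [H.even ht]
  rw [this, integral_Ioo_eq, intervalIntegral.integral_comp_neg (fun s => q.eval s * w s),
    integral_Ioo_eq, neg_neg]

/-- weighted bound -/
lemma Wt.bound (H : Wt α lam h w) {f : ℝ → ℝ} {B : ℝ} 
    (hf : ContinuousOn f (Set.Icc (-1) 1))
    (hB : ∀ x ∈ Set.Icc (-1:ℝ) 1, |f x| ≤ B) (q r : Polynomial ℝ)
    (hq : H.L (q * q) = 1) (hr : H.L (r * r) = 1) :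
    |∫ t in Set.Ioo (-1 : ℝ) 1, f t * (q * r).eval t * w t| ≤ B := by
  have i1 := H.cint (f := fun t => f t * (q * r).eval t) (hf.mul (q*r).continuousOn)
  have i2 := H.cint (f := fun t => B / 2 * (q*q + r*r).eval t)
    (continuousOn_const.mul (q*q+r*r).continuousOn)
  have e : ∫ t in Set.Ioo (-1 : ℝ) 1, B / 2 * (q*q + r*r).eval t * w t = B := by
    have : H.L (q*q+r*r) = 2 := by rw [map_add, hq, hr]; norm_num
    rw [H.L_apply] at this
    simp_rw [mul_assoc]
    rw [integral_const_mul, this]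
    ring
  calc _ ≤ ∫ t in Set.Ioo (-1 : ℝ) 1, |f t * (q * r).eval t * w t| := abs_integral_le_integral_abs
    _ ≤ ∫ t in Set.Ioo (-1 : ℝ) 1, B / 2 * (q*q + r*r).eval t * w t := by
      apply setIntegral_mono_on i1.abs i2 measurableSet_Ioo
      intro t ht
      rw [abs_mul, abs_mul, abs_of_nonneg (H.nonneg ht)]
      apply mul_le_mul_of_nonneg_right _ (H.nonneg ht)
      have hb := hB t (Set.Ioo_subset_Icc_self ht)
      have hB0 : 0 ≤ B := (abs_nonneg _).trans hb
      rw [eval_mul, eval_add, eval_mul, eval_mul]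
      have : |q.eval t * r.eval t| ≤ (q.eval t * q.eval t + r.eval t * r.eval t) / 2 := by
        rw [abs_le]; constructor <;> nlinarith [sq_nonneg (q.eval t + r.eval t), sq_nonneg (q.eval t - r.eval t)]
      calc _ ≤ B * ((q.eval t * q.eval t + r.eval t * r.eval t) / 2) := by gcongr
        _ = _ := by ring
    _ = B := e

lemma cheb_abs_le (k : ℤ) {x : ℝ} (hx : x ∈ Set.Icc (-1:ℝ) 1) : |(Chebyshev.T ℝ k).eval x| ≤ 1 := by
  rw [← Real.cos_arccos hx.1 hx.2, Chebyshev.T_real_cos]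
  exact Real.abs_cos_le_one _

lemma Wt.hasSum (H : Wt α lam h w) (c : ℤ → ℝ) (hc : Summable (fun k => |c k|))
    (hs : ∀ x ∈ Set.Icc (-1:ℝ) 1, HasSum (fun k => c k * (Chebyshev.T ℝ k).eval x) (gg h x))
    (q : Polynomial ℝ) :
    HasSum (fun k : ℤ => c k * H.L (Chebyshev.T ℝ k * q)) (H.Eg q) := by
  have hF : ∀ k : ℤ, IntegrableOn (fun t => (c k * (Chebyshev.T ℝ k * q).eval t) * w t)
      (Set.Ioo (-1:ℝ) 1) := fun k => H.cint (continuousOn_const.mul (Polynomial.continuousOn _))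
  have key := hasSum_integral_of_summable_integral_norm (μ := volume.restrict (Set.Ioo (-1:ℝ) 1))
    (F := fun (k:ℤ) t => (c k * (Chebyshev.T ℝ k * q).eval t) * w t) hF ?_
  · have e1 : (fun k : ℤ => c k * H.L (Chebyshev.T ℝ k * q)) = fun k =>
        ∫ t in Set.Ioo (-1:ℝ) 1, (c k * (Chebyshev.T ℝ k * q).eval t) * w t := by
      funext k
      rw [H.L_apply, ← integral_const_mul]
      congr 1; ext t; ring
    have e2 : H.Eg q = ∫ t in Set.Ioo (-1:ℝ) 1,
        ∑' k : ℤ, (c k * (Chebyshev.T ℝ k * q).eval t) * w t := by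
      unfold Wt.Eg
      apply setIntegral_congr_fun measurableSet_Ioo
      intro t ht
      have := (hs t (Set.Ioo_subset_Icc_self ht)).mul_right (q.eval t * w t)
      have h2 := this.tsum_eq
      simp only [eval_mul]
      rw [mul_assoc, ← h2]
      congr 1; ext k; ring
    rw [e1, e2]
    exact key
  · have i := (H.cint q.continuousOn).abs
    refine Summable.of_nonneg_of_le (fun k => integral_nonneg (fun t => norm_nonneg _)) ?_
      (hc.mul_right (∫ t in Set.Ioo (-1:ℝ) 1, |q.eval t * w t|))
    intro k
    rw [← integral_const_mul]
    apply setIntegral_mono_on (hF k).norm (i.const_mul _) measurableSet_Ioo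
    intro t ht
    have := cheb_abs_le k (Set.Ioo_subset_Icc_self ht)
    rw [Real.norm_eq_abs, eval_mul, abs_mul, abs_mul, abs_mul, abs_mul]
    calc |c k| * (|(Chebyshev.T ℝ k).eval t| * |q.eval t|) * |w t| 
        ≤ |c k| * (1 * |q.eval t|) * |w t| := by gcongr
      _ = _ := by ring

lemma Wt.deriv_w (H : Wt α lam h w) {t : ℝ} (ht : t ∈ Set.Ioo (-1:ℝ) 1) (h0 : t ≠ 0) :
    HasDerivAt w (w t * (2 * lam / t - 2 * α * t / (1 - t ^ 2) + deriv h t / h t)) t := by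
  have hp := one_sub_sq_pos ht
  have hh := H.hpos t (Set.Ioo_subset_Icc_self ht)
  have d1 : HasDerivAt (fun t : ℝ => (1 - t ^ 2) ^ α) ((1 - t^2)^α * (- 2 * α * t / (1 - t ^ 2))) t := by
    have : HasDerivAt (fun t : ℝ => 1 - t ^ 2) (-(2 * t)) t := by
      simpa using (hasDerivAt_pow 2 t).const_sub 1
    have := this.rpow_const (p := α) (Or.inl hp.ne')
    convert this using 1
    rw [Real.rpow_sub_one hp.ne']
    ring
  have d2 : HasDerivAt (fun t : ℝ => |t| ^ (2 * lam)) (|t| ^ (2 * lam) * (2 * lam / t)) t := by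
    have ha : |t| ≠ 0 := abs_ne_zero.2 h0
    have := (hasDerivAt_abs h0).rpow_const (p := 2 * lam) (Or.inl ha)
    convert this using 1
    rw [Real.rpow_sub_one ha]
    rcases lt_or_gt_of_ne h0 with h | h
    · rw [sign_neg h, abs_of_neg h]; simp; field_simp
    · rw [sign_pos h, abs_of_pos h]; simp; field_simp
  have d3 := (H.han t (Set.Ioo_subset_Icc_self ht)).differentiableAt.hasDerivAt
  have d := (d1.mul d3).mul d2
  have d' := d.congr_of_eventuallyEq (f₁ := w) (by
    filter_upwards [Ioo_mem_nhds ht.1 ht.2] with s hs using H.hw s hs)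
  refine d'.congr_deriv ?_
  rw [H.hw t ht]
  simp only [Pi.mul_apply]
  field_simp
  ring

lemma Wt.lim (H : Wt α lam h w) (R : Polynomial ℝ) (x : ℝ) (hx : x = -1 ∨ x = 0 ∨ x = 1) :
    Tendsto (fun t => (1 - t ^ 2) * (X * R).eval t * w t) (𝓝[Set.Ioo (-1) 1] x) (𝓝 0) := by
  have hxI : x ∈ Set.Icc (-1:ℝ) 1 := by rcases hx with rfl | rfl | rfl <;> norm_num
  have e : (fun t => (1 - t ^ 2) ^ (1 + α) * (t * |t| ^ (2 * lam)) * (h t * R.eval t))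
      =ᶠ[𝓝[Set.Ioo (-1) 1] x] (fun t => (1 - t ^ 2) * (X * R).eval t * w t) := by
    filter_upwards [self_mem_nhdsWithin] with t ht
    rw [H.hw t ht, Real.rpow_one_add' (one_sub_sq_pos ht).le (by linarith [H.hα]), eval_mul, eval_X]
    ring
  refine Tendsto.congr' e (Tendsto.mono_left ?_ nhdsWithin_le_nhds)
  have c1 : ContinuousAt (fun t => h t * R.eval t) x :=
    (H.han x hxI).continuousAt.mul R.continuous.continuousAt
  have c2 : ContinuousAt (fun t : ℝ => (1 - t ^ 2) ^ (1 + α)) x := by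
    apply ContinuousAt.rpow_const (by fun_prop) (Or.inr (by linarith [H.hα]))
  have c3 : ContinuousAt (fun t : ℝ => t * |t| ^ (2 * lam)) x := by
    by_cases h0 : x = 0
    · subst h0
      have c : Tendsto (fun t : ℝ => |t| ^ (1 + 2 * lam)) (𝓝 0) (𝓝 0) := by
        have : ContinuousAt (fun t : ℝ => |t| ^ (1 + 2 * lam)) 0 := by
          apply ContinuousAt.rpow_const (by fun_prop) (Or.inr (by linarith [H.hlam]))
        have := this.tendsto
        rwa [abs_zero, Real.zero_rpow (by linarith [H.hlam])] at this
      rw [ContinuousAt, zero_mul]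
      refine squeeze_zero_norm (fun t => le_of_eq ?_) c
      rw [Real.norm_eq_abs, abs_mul, Real.rpow_one_add' (abs_nonneg _) (by linarith [H.hlam]),
        abs_of_nonneg (a := |t| ^ (2 * lam)) (by positivity)]
    · exact continuousAt_id.mul (ContinuousAt.rpow_const (by fun_prop) (Or.inl (abs_ne_zero.2 h0)))
  have c := (c2.tendsto.mul c3.tendsto).mul c1.tendsto
  refine c.trans (le_of_eq (congrArg _ ?_))
  rcases hx with rfl | rfl | rfl
  · norm_num [Real.zero_rpow (show 1 + α ≠ 0 by linarith [H.hα])]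
  · simp
  · norm_num [Real.zero_rpow (show 1 + α ≠ 0 by linarith [H.hα])]

lemma Wt.ibp (H : Wt α lam h w) (q R : Polynomial ℝ) (hq : X * R = q) :
    H.L (C (-(2+2*α+2*lam)) * (X*q) + derivative q - X^2 * derivative q + C (2*lam) * R)
      + H.Eg q = 0 := by
  subst hq
  set q := X * R with hqR
  set P := C (-(2+2*α+2*lam)) * (X*q) + derivative q - X^2 * derivative q + C (2*lam) * R with hP
  have i1 := H.cint P.continuousOn
  have i2 := H.cint (f := fun t => gg h t * q.eval t) (H.gg_cont.mul q.continuousOn)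
  have i : IntegrableOn (fun t => P.eval t * w t + gg h t * q.eval t * w t) (Set.Ioo (-1:ℝ) 1) :=
    i1.add i2
  have hd : ∀ t ∈ Set.Ioo (-1:ℝ) 1, t ≠ 0 → HasDerivAt (fun t => (1 - t ^ 2) * q.eval t * w t)
      (P.eval t * w t + gg h t * q.eval t * w t) t := by
    intro t ht h0
    have hp := (one_sub_sq_pos ht).ne'
    have hh := (H.hpos t (Set.Ioo_subset_Icc_self ht)).ne'
    have d1 : HasDerivAt (fun t : ℝ => 1 - t ^ 2) (-(2 * t)) t := by
      simpa using (hasDerivAt_pow 2 t).const_sub 1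
    have d := (d1.mul (q.hasDerivAt t)).mul (H.deriv_w ht h0)
    refine d.congr_deriv ?_
    have e : q.eval t = t * R.eval t := by rw [hqR, eval_mul, eval_X]
    rw [hP]
    simp only [eval_add, eval_sub, eval_mul, eval_C, eval_X, eval_pow, Pi.mul_apply]
    rw [e]
    unfold gg
    field_simp
    ring
  have ii : ∀ a b : ℝ, a ≤ b → -1 ≤ a → b ≤ 1 → IntervalIntegrable
      (fun t => P.eval t * w t + gg h t * q.eval t * w t) volume a b := by
    intro a b hab ha hb
    rw [intervalIntegrable_iff_integrableOn_Ioo_of_le hab]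
    exact i.mono_set (Set.Ioo_subset_Ioo ha hb)
  have l : ∀ a b : ℝ, a < b → -1 ≤ a → b ≤ 1 → (a = -1 ∨ a = 0 ∨ a = 1) → (b = -1 ∨ b = 0 ∨ b = 1) →
      (∀ t ∈ Set.Ioo a b, t ≠ 0) →
      ∫ t in a..b, (P.eval t * w t + gg h t * q.eval t * w t) = 0 := by
    intro a b hab ha hb ha' hb' hn
    have s := Set.Ioo_subset_Ioo ha hb
    rw [intervalIntegral.integral_eq_sub_of_hasDerivAt_of_tendsto (fa := 0) (fb := 0) hab
      (fun t ht => hd t (s ht) (hn t ht)) (ii a b hab.le ha hb), sub_zero]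
    · refine (H.lim R a ha').mono_left ?_
      rw [← nhdsWithin_Ioo_eq_nhdsGT hab]
      exact nhdsWithin_mono _ s
    · refine (H.lim R b hb').mono_left ?_
      rw [← nhdsWithin_Ioo_eq_nhdsLT hab]
      exact nhdsWithin_mono _ s
  rw [H.L_apply, Wt.Eg, ← integral_add i1 i2, integral_Ioo_eq,
    ← intervalIntegral.integral_add_adjacent_intervals (b := 0)
      (ii (-1) 0 (by norm_num) le_rfl (by norm_num)) (ii 0 1 (by norm_num) (by norm_num) le_rfl),
    l (-1) 0 (by norm_num) (by norm_num) (by norm_num) (by norm_num) (by norm_num)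
      (fun t ht => ht.2.ne),
    l 0 1 (by norm_num) (by norm_num) (by norm_num) (by norm_num) (by norm_num)
      (fun t ht => ht.1.ne'), add_zero]

end


end Nevai

/-- Comparison with Nevai's result: for the even weight
`(1-x²)^α h(x) |x|^{2λ}` one has `a n = 1/2 + (-1)^{n+1} λ/(2n) + O(1/n²)` and
`b n = O(1/n²)`. -/
theorem nevai_even_weight
    (α lam : ℝ) (h : ℝ → ℝ)
    (hα : -1 < α)
    (hlam : -1 < 2 * lam) (hlam' : lam ≠ 0)
    (hh_even : ∀ t ∈ Set.Icc (-1 : ℝ) 1, h (-t) = h t)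
    (hh_an : ∀ t ∈ Set.Icc (-1 : ℝ) 1, AnalyticAt ℝ h t)
    (hh_pos : ∀ t ∈ Set.Icc (-1 : ℝ) 1, 0 < h t)
    (w : ℝ → ℝ)
    (hw : ∀ t ∈ Set.Ioo (-1 : ℝ) 1,
      w t = (1 - t ^ 2) ^ α * h t * |t| ^ (2 * lam))
    (p : ℕ → Polynomial ℝ)
    (hdeg : ∀ n : ℕ, (p n).degree = n)
    (hlead : ∀ n : ℕ, 0 < (p n).leadingCoeff)
    (horth : ∀ m n : ℕ,
      ∫ t in Set.Ioo (-1 : ℝ) 1, (p m).eval t * (p n).eval t * w t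
        = if m = n then 1 else 0)
    (a b : ℕ → ℝ)
    (ha : ∀ n : ℕ, 1 ≤ n →
      a n = ∫ t in Set.Ioo (-1 : ℝ) 1, t * (p n).eval t * (p (n - 1)).eval t * w t)
    (hb : ∀ n : ℕ,
      b n = ∫ t in Set.Ioo (-1 : ℝ) 1, t * ((p n).eval t) ^ 2 * w t) :
    ((fun n : ℕ => a n - (1 / 2 + (-1 : ℝ) ^ (n + 1) * lam / (2 * (n : ℝ))))
      =O[atTop] (fun n : ℕ => ((n : ℝ)⁻¹) ^ 2)) ∧
    ((fun n : ℕ => b n) =O[atTop] (fun n : ℕ => ((n : ℝ)⁻¹) ^ 2)) := by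
  have hp0 : p 0 = Polynomial.C ((p 0).coeff 0) := Polynomial.eq_C_of_degree_le_zero (by rw [hdeg 0]; simp)
  have hlead' : ∀ n, 0 < (p n).coeff n := by
    intro n
    have h1 := hlead n
    rwa [Polynomial.leadingCoeff, Polynomial.natDegree_eq_of_degree_eq_some (hdeg n)] at h1
  have hint : IntegrableOn w (Set.Ioo (-1 : ℝ) 1) := by
    have h1 := horth 0 0
    rw [if_pos rfl] at h1
    have h2 : IntegrableOn (fun t => (p 0).eval t * (p 0).eval t * w t) (Set.Ioo (-1 : ℝ) 1) := by
      by_contra hcon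
      rw [integral_undef hcon] at h1
      norm_num at h1
    have h3 := h2.const_mul (((p 0).coeff 0 * (p 0).coeff 0)⁻¹)
    have h0 := (hlead' 0).ne'
    refine h3.congr (Eventually.of_forall fun t => ?_)
    simp only
    rw [hp0, Polynomial.eval_C, Polynomial.coeff_C_zero]
    field_simp
  have H : Nevai.Wt α lam h w := ⟨hα, hlam, hh_even, hh_an, hh_pos, hw, hint⟩
  have hL1 : ∀ m n, H.L (p m * p n) = if m = n then 1 else 0 := by
    intro m n
    rw [← horth m n, H.L_apply]
    simp only [Polynomial.eval_mul]
  have O : Nevai.OP H.L p := ⟨hdeg, hlead', hL1, H.L_even⟩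
  have hnorm : ∀ n, H.L (p n * p n) = 1 := fun n => by rw [hL1, if_pos rfl]
  obtain ⟨c, hc, hcs⟩ := Nevai.cheb_expand (Nevai.gg h) H.gg_cos
  have hc' : Summable (fun k => |c k|) := by
    refine Summable.of_nonneg_of_le (fun k => abs_nonneg _) (fun k => ?_) hc
    have h1 : (1:ℝ) ≤ (1 + |(k:ℝ)|) ^ 6 := one_le_pow₀ (by linarith [abs_nonneg (k:ℝ)])
    nlinarith [abs_nonneg (c k)]
  obtain ⟨B, hB⟩ := isCompact_Icc.exists_bound_of_continuousOn H.gg_cont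
  obtain ⟨K, hK⟩ := O.final α lam H.Eg
    (fun q hq n m => by
      have h1 := H.bound q.continuousOn hq (p n) (p m) (hnorm n) (hnorm m)
      rw [H.L_apply]
      simpa only [Polynomial.eval_mul] using h1)
    H.ibp B
    (fun n => H.bound H.gg_cont (fun x hx => hB x hx) (p (n+1)) (p n) (hnorm _) (hnorm _))
    c hc (H.hasSum c hc' hcs)
  constructor
  · refine IsBigO.of_bound K ?_
    filter_upwards [eventually_ge_atTop 1] with n hn
    have e : a n = Nevai.ac H.L p n := by
      rw [ha n hn, Nevai.ac, H.L_apply]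
      simp only [Polynomial.eval_mul, Polynomial.eval_X]
    rw [e, Real.norm_eq_abs, Real.norm_eq_abs, abs_of_nonneg (a := ((n:ℝ)⁻¹) ^ 2) (by positivity)]
    refine (hK n hn).trans (le_of_eq ?_)
    rw [inv_pow, div_eq_mul_inv]
  · have e : (fun n : ℕ => b n) = fun _ => (0:ℝ) := by
      funext n
      have h1 := O.b_zero n
      rw [H.L_apply] at h1
      rw [hb n, ← h1]
      congr 1
      funext t
      simp only [Polynomial.eval_mul, Polynomial.eval_X]
      ring
    rw [e]
    exact isBigO_zero _ _
end

section
/- Fix c ∈ (−1,1) and define f(z) = i·Log φ(z) + arccos c for Im z > 0 and f(z) = −i·Log φ(z) + arccos c for Im z < 0, where Log is the principal logarithm. Then f extends to a function F analytic on ℂ∖((−∞,−1]∪[1,∞)) (i.e. there is an analytic F on this domain with F = f on ℂ∖ℝ), and F satisfies F(x) = arccos c − arccos x for all x ∈ (−1,1); in particular F(c) = 0 and F′(c) = 1/√(1−c²). -/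
open MeasureTheory Filter Asymptotics

noncomputable def rr (z : ℂ) : ℂ := (1 - z ^ 2) ^ (1 / 2 : ℂ)

lemma rr_sq (z : ℂ) : rr z ^ 2 = 1 - z ^ 2 := by
  unfold rr
  rw [← Complex.cpow_nat_mul]
  norm_num

lemma rr_ofReal {x a : ℝ} (h : (1 - (x : ℂ) ^ 2) = (a : ℂ)) (ha : 0 ≤ a) :
    rr x = (Real.sqrt a : ℂ) := by
  unfold rr
  rw [h, Real.sqrt_eq_rpow, Complex.ofReal_cpow ha]
  norm_num

lemma rr_I {z : ℂ} {a : ℝ} (h : (1 - z ^ 2) = (a : ℂ)) (ha : 0 ≤ a) :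
    rr z = (Real.sqrt a : ℂ) := by
  unfold rr
  rw [h, Real.sqrt_eq_rpow, Complex.ofReal_cpow ha]
  norm_num

lemma dom_slit {z : ℂ} (hz : z ∉ Complex.ofReal '' (Set.Iic (-1 : ℝ) ∪ Set.Ici (1 : ℝ))) :
    1 - z ^ 2 ∈ Complex.slitPlane := by
  rw [Complex.mem_slitPlane_iff]
  by_contra! h
  obtain ⟨h1, h2⟩ := h
  simp [pow_two] at h1 h2
  have h3 : z.re * z.im = 0 := by linarith
  rcases mul_eq_zero.mp h3 with h4 | h4
  · rw [h4] at h1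
    nlinarith [mul_self_nonneg z.im]
  · apply hz
    refine ⟨z.re, ?_, ?_⟩
    · rw [h4] at h1
      by_contra! h5
      simp at h5
      nlinarith
    · apply Complex.ext <;> simp [h4]

lemma w_im {z : ℂ} (hz : z ∉ Complex.ofReal '' (Set.Iic (-1 : ℝ) ∪ Set.Ici (1 : ℝ))) :
    (z + Complex.I * rr z).im ≠ 0 := by
  intro h
  have h1 : (z + Complex.I * rr z) * (z - Complex.I * rr z) = 1 := by
    have := rr_sq z
    have hI := Complex.I_sq
    linear_combination this - rr z ^ 2 * hI
  obtain ⟨t, ht⟩ : ∃ t : ℝ, z + Complex.I * rr z = t :=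
    ⟨(z + Complex.I * rr z).re, by apply Complex.ext <;> simp_all⟩
  rw [ht] at h1
  have ht0 : (t : ℂ) ≠ 0 := left_ne_zero_of_mul_eq_one h1
  have ht0' : t ≠ 0 := by exact_mod_cast ht0
  have h2 : z - Complex.I * rr z = (t : ℂ)⁻¹ := eq_inv_of_mul_eq_one_right h1
  have h3 : z = (((t + t⁻¹) / 2 : ℝ) : ℂ) := by
    push_cast
    linear_combination (ht + h2) / 2
  apply hz
  refine ⟨_, ?_, h3.symm⟩
  rcases lt_or_gt_of_ne ht0' with h | h
  · left
    have h4 : t⁻¹ < 0 := inv_lt_zero.mpr h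
    have h5 : t * t⁻¹ = 1 := mul_inv_cancel₀ ht0'
    simp only [Set.mem_Iic]
    nlinarith [sq_nonneg (t - t⁻¹)]
  · right
    have h4 : 0 < t⁻¹ := inv_pos.mpr h
    have h5 : t * t⁻¹ = 1 := mul_inv_cancel₀ ht0'
    simp only [Set.mem_Ici]
    nlinarith [sq_nonneg (t - t⁻¹)]

lemma not_real_of_im {z : ℂ} (S : Set ℝ) (h : z.im ≠ 0) : z ∉ Complex.ofReal '' S := by
  rintro ⟨x, _, rfl⟩
  simp at h

lemma s_eq (s : ℂ → ℂ)
    (hs_an : AnalyticOnNhd ℂ s ((Complex.ofReal '' Set.Icc (-1 : ℝ) 1)ᶜ))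
    (hs_sq : ∀ z ∉ Complex.ofReal '' Set.Icc (-1 : ℝ) 1, s z ^ 2 = z ^ 2 - 1)
    (hs_lim : Tendsto (fun z : ℂ => s z / z) (Bornology.cobounded ℂ) (nhds 1))
    (e : ℝ) (he : e ^ 2 = 1) (z : ℂ) (hz : 0 < e * z.im) : s z = e * Complex.I * rr z := by
  have hne : ∀ z : ℂ, 0 < e * z.im → z.im ≠ 0 := by
    intro z hz h
    simp [h] at hz
  have heC : (e : ℂ) ^ 2 = 1 := by exact_mod_cast he
  have he0 : (e : ℂ) ≠ 0 := by
    intro h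
    simp [h] at heC
  have hconv : Convex ℝ {z : ℂ | 0 < e * z.im} := by
    intro x hx y hy a b ha hb hab
    simp only [Set.mem_setOf_eq] at hx hy ⊢
    have : e * (a • x + b • y).im = a * (e * x.im) + b * (e * y.im) := by
      simp
      ring
    rw [this]
    rcases ha.eq_or_lt with h | h
    · have : b = 1 := by linarith
      subst this
      subst h
      simpa using hy
    · have := mul_pos h hx
      have := mul_nonneg hb hy.le
      linarith
  have key := hconv.isPreconnected.eq_or_eq_neg_of_sq_eq (f := s)
    (g := fun z => e * Complex.I * rr z) ?_ ?_ ?_ ?_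
  · rcases key with key | key
    · exact key hz
    · exfalso
      have hpos : ∀ᶠ w : ℂ in Bornology.cobounded ℂ, 0 < (s w / w).re := by
        have := (Complex.continuous_re.tendsto 1).comp hs_lim
        exact this.eventually (lt_mem_nhds (by simp))
      have ht : Tendsto (fun y : ℝ => (e : ℂ) * y * Complex.I) atTop (Bornology.cobounded ℂ) := by
        rw [← tendsto_norm_atTop_iff_cobounded]
        have h1 : |e| = 1 := by
          rw [← sq_eq_sq₀ (abs_nonneg _) zero_le_one]
          simpa using he
        simpa [h1] using tendsto_abs_atTop_atTop
      obtain ⟨y, hy, hy0⟩ := ((ht.eventually hpos).and (eventually_gt_atTop 0)).exists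
      have hk := key (x := (e : ℂ) * y * Complex.I) (by
        simp
        nlinarith)
      have hr : rr ((e : ℂ) * y * Complex.I) = (Real.sqrt (1 + y ^ 2) : ℂ) := by
        apply rr_I
        · push_cast
          rw [mul_pow, mul_pow, heC, Complex.I_sq]
          ring
        · positivity
      simp only [Pi.neg_apply, hr] at hk
      have hyC : (y : ℂ) ≠ 0 := by exact_mod_cast hy0.ne'
      have : s ((e : ℂ) * y * Complex.I) / ((e : ℂ) * y * Complex.I)
          = ((-(Real.sqrt (1 + y ^ 2) / y) : ℝ) : ℂ) := by
        rw [hk]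
        push_cast
        field_simp [Complex.I_ne_zero]
      rw [this, Complex.ofReal_re] at hy
      have : 0 ≤ Real.sqrt (1 + y ^ 2) / y := by positivity
      linarith
  · exact hs_an.continuousOn.mono fun z hz => not_real_of_im _ (hne z hz)
  · refine continuousOn_const.mul ?_
    unfold rr
    refine ContinuousOn.cpow (by fun_prop) continuousOn_const ?_
    intro z hz
    exact dom_slit (not_real_of_im _ (hne z hz))
  · intro z hz
    simp only [Pi.pow_apply]
    rw [hs_sq z (not_real_of_im _ (hne z hz)), mul_pow, mul_pow, heC, Complex.I_sq, rr_sq]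
    ring
  · intro z hz h
    have h0 : rr z = 0 := by simpa [he0] using h
    have := rr_sq z
    rw [h0] at this
    have h2 := dom_slit (not_real_of_im _ (hne z hz))
    rw [← this] at h2
    simp at h2

/-- The function `f(z) = ±i Log φ(z) + arccos c` (with `+` in the
upper half-plane and `-` in the lower half-plane) extends analytically to
`ℂ ∖ ((-∞,-1] ∪ [1,∞))`, and the extension satisfies `F(x) = arccos c - arccos x`
on `(-1,1)`; in particular `F(c) = 0` and `F'(c) = 1/√(1-c²)`. -/
theorem conformal_coordinate_at_singularity
    (s : ℂ → ℂ)
    (hs_an : AnalyticOnNhd ℂ s ((Complex.ofReal '' Set.Icc (-1 : ℝ) 1)ᶜ))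
    (hs_sq : ∀ z ∉ Complex.ofReal '' Set.Icc (-1 : ℝ) 1, s z ^ 2 = z ^ 2 - 1)
    (hs_lim : Tendsto (fun z : ℂ => s z / z) (Bornology.cobounded ℂ) (nhds 1))
    (φ : ℂ → ℂ) (hφ : ∀ z : ℂ, φ z = z + s z)
    (c : ℝ) (hc : c ∈ Set.Ioo (-1 : ℝ) 1) :
    ∃ F : ℂ → ℂ,
      AnalyticOnNhd ℂ F
        ((Complex.ofReal '' (Set.Iic (-1 : ℝ) ∪ Set.Ici (1 : ℝ)))ᶜ) ∧
      (∀ z : ℂ, 0 < z.im →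
        F z = Complex.I * Complex.log (φ z) + (Real.arccos c : ℂ)) ∧
      (∀ z : ℂ, z.im < 0 →
        F z = -Complex.I * Complex.log (φ z) + (Real.arccos c : ℂ)) ∧
      (∀ x : ℝ, x ∈ Set.Ioo (-1 : ℝ) 1 →
        F (x : ℂ) = ((Real.arccos c - Real.arccos x : ℝ) : ℂ)) ∧
      F (c : ℂ) = 0 ∧
      deriv F (c : ℂ) = ((1 / Real.sqrt (1 - c ^ 2) : ℝ) : ℂ) := by
  have hF : AnalyticOnNhd ℂ
      (fun z => Complex.I * Complex.log (z + Complex.I * rr z) + (Real.arccos c : ℂ))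
      ((Complex.ofReal '' (Set.Iic (-1 : ℝ) ∪ Set.Ici (1 : ℝ)))ᶜ) := by
    intro z hz
    have hr : AnalyticAt ℂ rr z := by
      unfold rr
      exact AnalyticAt.cpow (by fun_prop) analyticAt_const (dom_slit hz)
    refine (analyticAt_const.mul (AnalyticAt.clog ?_ ?_)).add analyticAt_const
    · exact analyticAt_id.add (analyticAt_const.mul hr)
    · exact Complex.mem_slitPlane_iff.mpr (Or.inr (w_im hz))
  have hx : ∀ x : ℝ, x ∈ Set.Ioo (-1 : ℝ) 1 →
      Complex.I * Complex.log ((x : ℂ) + Complex.I * rr x) + (Real.arccos c : ℂ)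
        = ((Real.arccos c - Real.arccos x : ℝ) : ℂ) := by
    intro x hx
    have h1 : (0 : ℝ) ≤ 1 - x ^ 2 := by nlinarith [hx.1, hx.2]
    have h2 : (x : ℂ) + Complex.I * rr x = Complex.exp (Real.arccos x * Complex.I) := by
      rw [rr_ofReal (a := 1 - x ^ 2) (by push_cast; rfl) h1, Complex.exp_mul_I,
        ← Complex.ofReal_cos, ← Complex.ofReal_sin, Real.cos_arccos hx.1.le hx.2.le,
        Real.sin_arccos]
      ring
    have h3 := Real.arccos_nonneg x
    have h4 := Real.arccos_le_pi x
    rw [h2, Complex.log_exp (by simp; linarith [Real.pi_pos]) (by simpa using h4)]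
    push_cast
    linear_combination (Real.arccos x : ℂ) * Complex.I_sq
  refine ⟨_, hF, ?_, ?_, hx, ?_, ?_⟩
  · intro z hz
    have := s_eq s hs_an hs_sq hs_lim 1 (by norm_num) z (by simpa using hz)
    simp only [hφ, this]
    simp
  · intro z hz
    have := s_eq s hs_an hs_sq hs_lim (-1) (by norm_num) z (by simpa using hz)
    have hw := w_im (not_real_of_im (Set.Iic (-1 : ℝ) ∪ Set.Ici (1 : ℝ)) hz.ne)
    have hinv : φ z = (z + Complex.I * rr z)⁻¹ := by
      rw [hφ, this]
      apply eq_inv_of_mul_eq_one_right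
      push_cast
      linear_combination rr_sq z - rr z ^ 2 * Complex.I_sq
    rw [hinv, Complex.log_inv]
    · ring
    · intro h
      rw [Complex.arg_eq_pi_iff] at h
      exact hw h.2
  · have := hx c hc
    simpa using this
  · have hcd : (c : ℂ) ∈ (Complex.ofReal '' (Set.Iic (-1 : ℝ) ∪ Set.Ici (1 : ℝ)))ᶜ := by
      rintro ⟨y, hy, hyc⟩
      have : y = c := by exact_mod_cast hyc
      subst this
      rcases hy with hy | hy
      · exact absurd hc.1 (not_lt.mpr hy)
      · exact absurd hc.2 (not_lt.mpr hy)
    have hd := (hF _ hcd).differentiableAt.hasDerivAt.comp_ofReal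
    have hd2 : HasDerivAt (fun x : ℝ => ((Real.arccos c - Real.arccos x : ℝ) : ℂ))
        ((1 / Real.sqrt (1 - c ^ 2) : ℝ) : ℂ) c := by
      apply HasDerivAt.ofReal_comp
      have := (Real.hasDerivAt_arccos hc.1.ne' hc.2.ne).const_sub (Real.arccos c)
      simpa using this
    refine hd.unique (hd2.congr_of_eventuallyEq ?_)
    filter_upwards [Ioo_mem_nhds hc.1 hc.2] with x hx'
    exact hx x hx'
end

section
/- (Residue computation for the order-1/n term.) Let θ ∈ (0,π), Φ ∈ ℝ, λ ∈ ℝ, d > 0 and n ∈ ℕ, and set x = cos θ. Define the 2×2 complex matrix E = (e^{−πi/4}/(√2·(1−x²)^{1/4})) · d^{σ₃} · [[ e^{iθ/2} , i·e^{−iθ/2} ], [ −i·e^{−iθ/2} , e^{iθ/2} ]] · e^{−(iΦ/2)σ₃}. Then E is invertible (with det E = 1) and (i/4)·√(1−x²) · E · e^{inθσ₃} · [[ −2λ² , −2λ ], [ 2λ , 2λ² ]] · e^{−inθσ₃} · E^{−1} = d^{σ₃} · [[ C₁₁ , C₁₂ ], [ C₂₁ , −C₁₁ ]] · d^{−σ₃},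 where C₁₁ = −(1/2)λ²x + (1/2)λ·sin(2nθ − Φ), C₁₂ = (i/2)λ² − (i/2)λx·sin(2nθ − Φ) − (i/2)λ√(1−x²)·cos(2nθ − Φ), and C₂₁ = (i/2)λ² − (i/2)λx·sin(2nθ − Φ) + (i/2)λ√(1−x²)·cos(2nθ − Φ). -/
open Complex Matrix

lemma core_aux (k a p q d s x L S C : ℂ) (ha : a ≠ 0) (hp : p ≠ 0) (hq : q ≠ 0) (hd : d ≠ 0)
    (hk : k ^ 2 * s = -I / 2) (hx : x = (a ^ 2 + (a⁻¹) ^ 2) / 2)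
    (hs : s = ((a⁻¹) ^ 2 - a ^ 2) * I / 2)
    (hS : S = ((q⁻¹ * p) ^ 2 - (q * p⁻¹) ^ 2) * I / 2)
    (hC : C = ((q * p⁻¹) ^ 2 + (q⁻¹ * p) ^ 2) / 2)
    (E : Matrix (Fin 2) (Fin 2) ℂ)
    (hE : E = k • (!![d, 0; 0, d⁻¹] * !![a, I * a⁻¹; -(I * a⁻¹), a] * !![p⁻¹, 0; 0, p])) :
    E.det = 1 ∧ IsUnit E ∧
    (I / 4 * s) • (E * !![q, 0; 0, q⁻¹] * !![-(2 * L ^ 2), -(2 * L); 2 * L, 2 * L ^ 2] *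
      !![q⁻¹, 0; 0, q] * E⁻¹)
    = !![d, 0; 0, d⁻¹] *
      !![-(1 / 2) * L ^ 2 * x + 1 / 2 * L * S,
        I / 2 * L ^ 2 - I / 2 * (L * x * S) - I / 2 * (L * s * C);
        I / 2 * L ^ 2 - I / 2 * (L * x * S) + I / 2 * (L * s * C),
        -(-(1 / 2) * L ^ 2 * x + 1 / 2 * L * S)] * !![d⁻¹, 0; 0, d] := by
  have hI : I ^ 2 = -1 := I_sq
  have hE' : E = !![k * (d * a * p⁻¹), k * (d * I * a⁻¹ * p);
      -(k * (d⁻¹ * I * a⁻¹ * p⁻¹)), k * (d⁻¹ * a * p)] := by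
    rw [hE]
    ext i j
    fin_cases i <;> fin_cases j <;> simp [-mul_eq_mul_left_iff, -mul_eq_mul_right_iff] <;> ring
  have hdet : E.det = 1 := by
    have h2 : E.det = k ^ 2 * (a ^ 2 - (a⁻¹) ^ 2) := by
      rw [hE', Matrix.det_fin_two_of]
      field_simp
      rw [hI]
      ring
    have h3 : a ^ 2 - (a⁻¹) ^ 2 = 2 * I * s := by
      rw [hs]
      linear_combination (-((a⁻¹) ^ 2 - a ^ 2)) * hI
    rw [h2, h3]
    linear_combination 2 * I * hk - hI
  refine ⟨hdet, (Matrix.isUnit_iff_isUnit_det E).2 (by rw [hdet]; exact isUnit_one), ?_⟩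
  have hinv : E⁻¹ = !![k * (d⁻¹ * a * p), -(k * (d * I * a⁻¹ * p));
      k * (d⁻¹ * I * a⁻¹ * p⁻¹), k * (d * a * p⁻¹)] := by
    rw [Matrix.inv_def, hdet, Ring.inverse_one, one_smul, hE', Matrix.adjugate_fin_two_of]
    simp
  have hks : I / 4 * s * k ^ 2 = 1 / 8 := by
    linear_combination I / 4 * hk - 1 / 8 * hI
  rw [hinv, hE']
  have key : ∀ u v w : ℂ, u = k ^ 2 * v → v / 8 = w → I / 4 * s * u = w := by
    intro u v w h1 h2
    rw [h1, ← h2]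
    linear_combination v * hks
  ext i j
  fin_cases i <;> fin_cases j
  · simp [Matrix.mul_apply, Fin.sum_univ_two]
    refine key _ (-2 * L ^ 2 * (a ^ 2 + (a⁻¹) ^ 2) - 2 * L * I * ((q * p⁻¹) ^ 2 - (q⁻¹ * p) ^ 2)) _ ?_ ?_
    · field_simp
      ring_nf
      simp only [hI]
      ring
    · rw [hx, hS]
      field_simp
      ring
  · simp [Matrix.mul_apply, Fin.sum_univ_two]
    refine key _ (d ^ 2 * (4 * I * L ^ 2 - 2 * L * (a ^ 2 * (q * p⁻¹) ^ 2 - (a⁻¹) ^ 2 * (q⁻¹ * p) ^ 2))) _ ?_ ?_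
    · field_simp
      ring_nf
      simp only [hI]
      ring
    · rw [hx, hS, hC, hs]
      field_simp
      ring_nf
      simp only [hI]
      ring
  · simp [Matrix.mul_apply, Fin.sum_univ_two]
    refine key _ ((d⁻¹) ^ 2 * (4 * I * L ^ 2 - 2 * L * ((a⁻¹) ^ 2 * (q * p⁻¹) ^ 2 - a ^ 2 * (q⁻¹ * p) ^ 2))) _ ?_ ?_
    · field_simp
      ring_nf
      simp only [hI]
      ring
    · rw [hx, hS, hC, hs]
      field_simp
      ring_nf
      simp only [hI]
      ring
  · simp [Matrix.mul_apply, Fin.sum_univ_two]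
    refine key _ (-(-2 * L ^ 2 * (a ^ 2 + (a⁻¹) ^ 2) - 2 * L * I * ((q * p⁻¹) ^ 2 - (q⁻¹ * p) ^ 2))) _ ?_ ?_
    · field_simp
      ring_nf
      simp only [hI]
      ring
    · rw [hx, hS]
      field_simp
      ring

/-- Residue computation for the order-`1/n` term: with
`E = (e^{-πi/4}/(√2 (1-x²)^{1/4})) d^{σ₃} [[e^{iθ/2}, i e^{-iθ/2}],[-i e^{-iθ/2}, e^{iθ/2}]] e^{-(iΦ/2)σ₃}`,
one has `det E = 1` and
`(i/4)√(1-x²) E e^{inθσ₃} [[-2λ², -2λ],[2λ, 2λ²]] e^{-inθσ₃} E⁻¹ = d^{σ₃} [[C₁₁,C₁₂],[C₂₁,-C₁₁]] d^{-σ₃}`. -/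
theorem residue_order_one_over_n
    (θ Φ lam d : ℝ) (hθ : θ ∈ Set.Ioo 0 Real.pi) (hd : 0 < d)
    (n : ℕ) (x : ℝ) (hx : x = Real.cos θ)
    (E : Matrix (Fin 2) (Fin 2) ℂ)
    (hE : E = (Complex.exp (-(Real.pi : ℂ) * Complex.I / 4) /
        ((Real.sqrt 2 : ℂ) * (((1 - x ^ 2) ^ ((1 : ℝ) / 4) : ℝ) : ℂ))) •
      (!![((d : ℝ) : ℂ), 0; 0, (((d : ℝ) : ℂ))⁻¹] *
       !![Complex.exp (Complex.I * (θ : ℂ) / 2),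
            Complex.I * Complex.exp (-(Complex.I * (θ : ℂ) / 2));
          -(Complex.I * Complex.exp (-(Complex.I * (θ : ℂ) / 2))),
            Complex.exp (Complex.I * (θ : ℂ) / 2)] *
       !![Complex.exp (-(Complex.I * (Φ : ℂ) / 2)), 0;
          0, Complex.exp (Complex.I * (Φ : ℂ) / 2)])) :
    E.det = 1 ∧ IsUnit E ∧
    (Complex.I / 4 * ((Real.sqrt (1 - x ^ 2) : ℝ) : ℂ)) •
      (E *
       !![Complex.exp (Complex.I * (n : ℂ) * (θ : ℂ)), 0;
          0, Complex.exp (-(Complex.I * (n : ℂ) * (θ : ℂ)))] *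
       !![(-(2 * lam ^ 2) : ℂ), (-(2 * lam) : ℂ);
          ((2 * lam : ℝ) : ℂ), ((2 * lam ^ 2 : ℝ) : ℂ)] *
       !![Complex.exp (-(Complex.I * (n : ℂ) * (θ : ℂ))), 0;
          0, Complex.exp (Complex.I * (n : ℂ) * (θ : ℂ))] *
       E⁻¹)
    = !![((d : ℝ) : ℂ), 0; 0, (((d : ℝ) : ℂ))⁻¹] *
      !![((-(1 / 2) * lam ^ 2 * x + 1 / 2 * lam * Real.sin (2 * n * θ - Φ) : ℝ) : ℂ),
          Complex.I / 2 * ((lam ^ 2 : ℝ) : ℂ)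
            - Complex.I / 2 * ((lam * x * Real.sin (2 * n * θ - Φ) : ℝ) : ℂ)
            - Complex.I / 2 *
              ((lam * Real.sqrt (1 - x ^ 2) * Real.cos (2 * n * θ - Φ) : ℝ) : ℂ);
          Complex.I / 2 * ((lam ^ 2 : ℝ) : ℂ)
            - Complex.I / 2 * ((lam * x * Real.sin (2 * n * θ - Φ) : ℝ) : ℂ)
            + Complex.I / 2 *
              ((lam * Real.sqrt (1 - x ^ 2) * Real.cos (2 * n * θ - Φ) : ℝ) : ℂ),
          ((-(-(1 / 2) * lam ^ 2 * x + 1 / 2 * lam * Real.sin (2 * n * θ - Φ)) : ℝ) : ℂ)] *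
      !![(((d : ℝ) : ℂ))⁻¹, 0; 0, ((d : ℝ) : ℂ)] := by
  have hsin : 0 < Real.sin θ := Real.sin_pos_of_mem_Ioo hθ
  have h1x : 1 - x ^ 2 = Real.sin θ ^ 2 := by rw [hx, Real.sin_sq]
  have hsq : Real.sqrt (1 - x ^ 2) = Real.sin θ := by rw [h1x, Real.sqrt_sq hsin.le]
  have hr : ((1 - x ^ 2) ^ ((1 : ℝ) / 4)) ^ 2 = Real.sin θ := by
    rw [← hsq, Real.sqrt_eq_rpow, ← Real.rpow_natCast, ← Real.rpow_mul (by rw [h1x]; positivity)]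
    norm_num
  have e1 : ∀ z : ℂ, Complex.exp z ^ 2 = Complex.exp (2 * z) := fun z => by
    rw [← Complex.exp_nat_mul]; norm_num
  have hk : (Complex.exp (-(Real.pi : ℂ) * Complex.I / 4) /
        ((Real.sqrt 2 : ℂ) * (((1 - x ^ 2) ^ ((1 : ℝ) / 4) : ℝ) : ℂ))) ^ 2 * (Real.sin θ : ℂ)
        = -I / 2 := by
    have hs0 : (Real.sin θ : ℂ) ≠ 0 := by exact_mod_cast hsin.ne'
    have h2 : (Real.sqrt 2 : ℂ) ^ 2 = 2 := by
      rw [← Complex.ofReal_pow, Real.sq_sqrt (by norm_num)]; norm_num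
    have h3 : Complex.exp (-(Real.pi : ℂ) * Complex.I / 4) ^ 2 = -I := by
      rw [e1, ← Complex.exp_neg_pi_div_two_mul_I]
      congr 1; ring
    rw [div_pow, mul_pow, h2, h3, ← Complex.ofReal_pow, hr]
    field_simp
  have hq2 : Complex.exp (Complex.I * (n : ℂ) * (θ : ℂ)) *
      (Complex.exp (Complex.I * (Φ : ℂ) / 2))⁻¹ =
      Complex.exp (I * (2 * n * θ - Φ) / 2) := by
    rw [← Complex.exp_neg, ← Complex.exp_add]; congr 1; ring
  have hq3 : (Complex.exp (Complex.I * (n : ℂ) * (θ : ℂ)))⁻¹ *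
      (Complex.exp (Complex.I * (Φ : ℂ) / 2)) =
      Complex.exp (-(I * (2 * n * θ - Φ) / 2)) := by
    rw [← Complex.exp_neg, ← Complex.exp_add]; congr 1; ring
  have main := core_aux _ (Complex.exp (Complex.I * (θ : ℂ) / 2))
    (Complex.exp (Complex.I * (Φ : ℂ) / 2)) (Complex.exp (Complex.I * (n : ℂ) * (θ : ℂ)))
    (d : ℂ) (Real.sin θ : ℂ) (x : ℂ) (lam : ℂ) (Real.sin (2 * n * θ - Φ) : ℂ)
    (Real.cos (2 * n * θ - Φ) : ℂ) (Complex.exp_ne_zero _) (Complex.exp_ne_zero _)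
    (Complex.exp_ne_zero _) (by exact_mod_cast hd.ne') hk
    (by
      rw [hx, ← Complex.exp_neg, e1, e1, Complex.ofReal_cos, Complex.cos]
      congr 3 <;> ring)
    (by
      rw [← Complex.exp_neg, e1, e1, Complex.ofReal_sin, Complex.sin]
      congr 4 <;> ring)
    (by
      rw [hq2, hq3, e1, e1, Complex.ofReal_sin, Complex.sin]
      push_cast
      congr 4 <;> ring)
    (by
      rw [hq2, hq3, e1, e1, Complex.ofReal_cos, Complex.cos]
      push_cast
      congr 3 <;> ring)
    E (by rw [hE, Complex.exp_neg, Complex.exp_neg])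
  rw [hsq, Complex.exp_neg]
  push_cast at main ⊢
  exact main
end
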